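/- Let γ ∈ [0,1), let K be a coagulation kernel satisfying the standing assumptions, let ρ ∈ (γ,1), β = 1/(ρ−γ), δ ∈ (0, ρ−γ) and R₀ sufficiently large. Then there exists a nonnegative Radon measure h on [0,∞) belonging to the set 𝒴, i.e. satisfying R^{ρ−1} ∫_{[0,R]} dh ≤ 1 and R^{ρ−1} ∫_{[0,R]} dh ≥ (1 − (R₀/R)^δ)₊ for all R > 0, which is a weak stationary solution: for every ψ ∈ C_c^1([0,∞)), ∫_0^∞ ψ'(x) (∫_0^x ∫_{x−y}^∞ (K(y,z)/z) dh(z) dh(y)) dx − β ∫ (xψ(x))' dh(x) + βρ ∫ ψ(x) dh(x) = 0. -/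

import Mathlib

open MeasureTheory Real Set Filter Topology

noncomputable section

namespace Smol

/-- Standing assumptions on the coagulation kernel `K`: continuity on `(0,∞)²`, symmetry,
nonnegativity, homogeneity of degree `γ` and the growth bound `K(x,y) ≤ C(x^γ + y^γ)`. -/
structure KernelHyp (K : ℝ → ℝ → ℝ) (γ C : ℝ) : Prop where
  cont : ContinuousOn (fun p : ℝ × ℝ => K p.1 p.2) (Ioi (0:ℝ) ×ˢ Ioi (0:ℝ))
  symm : ∀ x y : ℝ, 0 < x → 0 < y → K x y = K y x
  nonneg : ∀ x y : ℝ, 0 < x → 0 < y → 0 ≤ K x y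
  homog : ∀ a x y : ℝ, 0 < a → 0 < x → 0 < y → K (a * x) (a * y) = a ^ γ * K x y
  growth : ∀ x y : ℝ, 0 < x → 0 < y → K x y ≤ C * (x ^ γ + y ^ γ)

/-- `I[h](x) = ∫_0^x ∫_{x-y}^∞ (K(y,z)/z) dh(z) dh(y)` for a measure `h`. -/
def Imeas (K : ℝ → ℝ → ℝ) (μ : Measure ℝ) (x : ℝ) : ℝ :=
  ∫ y in Ioc (0:ℝ) x, (∫ z in Ici (x - y), K y z / z ∂μ) ∂μ

section PoincareMiranda

variable {ι : Type*} [DecidableEq ι]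

/-- The cup product of the discrete differentials of the functions `u i`, `i ∈ L`, evaluated
modulo `2` on the sum of all monotone lattice paths from `z` with distinct steps in `D`. -/
def cupSum (u : ι → (ι → ℤ) → ZMod 2) : List ι → Finset ι → (ι → ℤ) → ZMod 2
  | [], _, _ => 1
  | i :: L, D, z => ∑ a ∈ D, (u i (z + Pi.single a 1) + u i z) *
      cupSum u L (D.erase a) (z + Pi.single a 1)

lemma sum_erase_symm_eq_zero (D : Finset ι) (g : ι → ι → ZMod 2) (hg : ∀ a b, g a b = g b a) :
    ∑ a ∈ D, ∑ b ∈ D.erase a, g a b = 0 := by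
  rw [Finset.sum_sigma']
  refine Finset.sum_involution (fun p _ => ⟨p.2, p.1⟩) ?_ ?_ ?_ ?_
  · intro p _
    simp only [hg p.2 p.1]
    exact CharTwo.add_self_eq_zero _
  · rintro ⟨a, b⟩ h _ heq
    simp at h heq
    exact h.2.1 heq.1
  · rintro ⟨a, b⟩ h
    simp at h ⊢
    exact ⟨h.2.2, fun h' => h.2.1 h'.symm, h.1⟩
  · rintro ⟨a, b⟩ h
    rfl

lemma sum_erase_comm (D : Finset ι) (g : ι → ι → ZMod 2) :
    ∑ a ∈ D, ∑ b ∈ D.erase a, g a b = ∑ a ∈ D, ∑ b ∈ D.erase a, g b a := by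
  refine Finset.sum_comm' ?_
  intro a b
  simp only [Finset.mem_erase]
  tauto

lemma cupSum_closed (u : ι → (ι → ℤ) → ZMod 2) (L : List ι) :
    ∀ (D : Finset ι) (z : ι → ℤ), D.card = L.length + 1 →
      ∑ a ∈ D, cupSum u L (D.erase a) z =
        ∑ a ∈ D, cupSum u L (D.erase a) (z + Pi.single a 1) := by
  induction L with
  | nil => intro D z _; rfl
  | cons i L ih =>
    intro D z hD
    simp only [cupSum]
    rw [sum_erase_comm]
    have h1 : ∑ a ∈ D, ∑ b ∈ D.erase a, (u i (z + Pi.single a 1) + u i z) *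
        cupSum u L ((D.erase b).erase a) (z + Pi.single a 1) =
        ∑ a ∈ D, ∑ b ∈ D.erase a, (u i (z + Pi.single a 1) + u i z) *
        cupSum u L ((D.erase a).erase b) (z + Pi.single a 1 + Pi.single b 1) := by
      refine Finset.sum_congr rfl fun a ha => ?_
      rw [← Finset.mul_sum, ← Finset.mul_sum, ← ih]
      · congr 1
        exact Finset.sum_congr rfl fun b _ => by rw [Finset.erase_right_comm]
      · rw [Finset.card_erase_of_mem ha, hD]; simp
    rw [h1, ← sub_eq_zero, CharTwo.sub_eq_add, ← Finset.sum_add_distrib]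
    simp only [← Finset.sum_add_distrib, ← add_mul]
    rw [← sum_erase_symm_eq_zero D (fun a b => (u i z + u i (z + Pi.single a 1 + Pi.single b 1)) *
      cupSum u L ((D.erase a).erase b) (z + Pi.single a 1 + Pi.single b 1))]
    · refine Finset.sum_congr rfl fun a _ => Finset.sum_congr rfl fun b _ => ?_
      congr 1
      have := CharTwo.add_self_eq_zero (u i (z + Pi.single a 1))
      linear_combination this
    · intro a b
      simp only [Finset.erase_right_comm (a := a), add_right_comm z]

lemma cupSum_eq_zero (u : ι → (ι → ℤ) → ZMod 2) (k : ℤ)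
    (h0 : ∀ i z, z i ≤ 0 → u i z = 0) (h1 : ∀ i z, k ≤ z i → u i z = 1) (j : ι) (L : List ι) :
    ∀ (D : Finset ι) (z : ι → ℤ), j ∈ L → j ∉ D → (z j ≤ 0 ∨ k ≤ z j) → cupSum u L D z = 0 := by
  induction L with
  | nil => simp
  | cons i L ih =>
    intro D z hj hD hz
    refine Finset.sum_eq_zero fun a ha => ?_
    have haj : j ≠ a := fun h => hD (h ▸ ha)
    have hzj : (z + Pi.single a 1 : ι → ℤ) j = z j := by simp [haj]
    by_cases hij : j = i
    · subst hij
      have : u j (z + Pi.single a 1) = u j z := by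
        rcases hz with hz | hz
        · rw [h0 _ _ hz, h0 _ _ (hzj ▸ hz)]
        · rw [h1 _ _ hz, h1 _ _ (hzj ▸ hz)]
      rw [this, CharTwo.add_self_eq_zero, zero_mul]
    · rw [ih, mul_zero]
      · simpa [hij] using hj
      · exact fun h => hD (Finset.mem_of_mem_erase h)
      · rwa [hzj]

lemma exists_of_cupSum_ne_zero (u : ι → (ι → ℤ) → ZMod 2) (L : List ι) :
    ∀ (D : Finset ι) (z : ι → ℤ), cupSum u L D z ≠ 0 → ∀ i ∈ L, ∃ p q : ι → ℤ,
      (∀ j, z j ≤ p j ∧ p j ≤ z j + if j ∈ D then 1 else 0) ∧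
      (∀ j, z j ≤ q j ∧ q j ≤ z j + if j ∈ D then 1 else 0) ∧ u i p ≠ u i q := by
  induction L with
  | nil => simp
  | cons i L ih =>
    intro D z h l hl
    obtain ⟨a, ha, hne⟩ := Finset.exists_ne_zero_of_sum_ne_zero h
    have hbox : ∀ p : ι → ℤ, (∀ j, (z + Pi.single a 1 : ι → ℤ) j ≤ p j ∧
        p j ≤ (z + Pi.single a 1 : ι → ℤ) j + if j ∈ D.erase a then 1 else 0) →
        ∀ j, z j ≤ p j ∧ p j ≤ z j + if j ∈ D then 1 else 0 := by
      intro p hp j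
      have := hp j
      by_cases hja : j = a
      · subst hja; simp [ha] at this ⊢; omega
      · simpa [hja] using this
    rcases List.mem_cons.1 hl with rfl | hl
    · refine ⟨z + Pi.single a 1, z, hbox _ fun j => ⟨le_rfl, by split_ifs <;> simp⟩,
        fun j => ⟨le_rfl, by split_ifs <;> simp⟩, fun heq => ?_⟩
      exact left_ne_zero_of_mul hne (by rw [heq, CharTwo.add_self_eq_zero])
    · obtain ⟨p, q, hp, hq, hpq⟩ := ih _ _ (right_ne_zero_of_mul hne) l hl
      exact ⟨p, q, hbox p hp, hbox q hq, hpq⟩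

variable [Fintype ι]

/-- Lattice points with coordinates in `[0, k]` in the directions of `D` and frozen elsewhere. -/
def latticeBox (k : ℤ) (D : Finset ι) (c : ι → ℤ) : Finset (ι → ℤ) :=
  Fintype.piFinset fun j => if j ∈ D then Finset.Icc 0 k else {c j}

lemma mem_latticeBox {k : ℤ} {D : Finset ι} {c z : ι → ℤ} :
    z ∈ latticeBox k D c ↔ ∀ j, (j ∈ D → 0 ≤ z j ∧ z j ≤ k) ∧ (j ∉ D → z j = c j) := by
  rw [latticeBox, Fintype.mem_piFinset]
  refine forall_congr' fun j => ?_
  by_cases h : j ∈ D <;> simp [h]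

lemma sum_latticeBox_shift {k : ℤ} {D : Finset ι} {c : ι → ℤ} {a : ι} (ha : a ∈ D)
    (f : (ι → ℤ) → ZMod 2) (hf : ∀ z, (z a ≤ 0 ∨ k ≤ z a) → f z = 0) :
    ∑ z ∈ latticeBox k D c, f (z + Pi.single a 1) = ∑ z ∈ latticeBox k D c, f z := by
  refine Finset.sum_bij_ne_zero (fun z _ _ => z + Pi.single a 1) ?_ ?_ ?_ ?_
  · intro z hz hne
    rw [mem_latticeBox] at hz ⊢
    intro j
    by_cases hja : j = a
    · subst hja
      have h1 := (hz j).1 ha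
      have h2 : ¬ ((z + Pi.single j 1 : ι → ℤ) j ≤ 0 ∨ k ≤ (z + Pi.single j 1 : ι → ℤ) j) :=
        fun h => hne (hf _ h)
      simp at h2 ⊢
      exact ⟨fun _ => by omega, fun h => absurd ha h⟩
    · simpa [hja] using hz j
  · intro z _ _ w _ _ h
    simpa using h
  · intro z hz hne
    have h2 : ¬ (z a ≤ 0 ∨ k ≤ z a) := fun h => hne (hf _ h)
    refine ⟨z - Pi.single a 1, ?_, by simpa using hne, by simp⟩
    rw [mem_latticeBox] at hz ⊢
    intro j
    by_cases hja : j = a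
    · subst hja
      simp at h2 ⊢
      exact ⟨fun _ => by omega, fun h => absurd ha h⟩
    · simpa [hja] using hz j
  · intros; rfl

lemma sum_latticeBox_cupSum (u : ι → (ι → ℤ) → ZMod 2) (k : ℤ) (hk : 0 < k)
    (h0 : ∀ i z, z i ≤ 0 → u i z = 0) (h1 : ∀ i z, k ≤ z i → u i z = 1) (L : List ι) :
    ∀ (c : ι → ℤ), L.Nodup → ∑ z ∈ latticeBox k L.toFinset c, cupSum u L L.toFinset z = 1 := by
  induction L with
  | nil => intro c _; simp [latticeBox, cupSum]
  | cons i L ih =>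
    intro c hL
    have hiL : i ∉ L := (List.nodup_cons.1 hL).1
    set D := (i :: L).toFinset with hD
    have hiD : i ∈ D := by simp [hD]
    have hDi : D.erase i = L.toFinset := by
      rw [hD, List.toFinset_cons, Finset.erase_insert (by simpa using hiL)]
    let s : (ι → ℤ) → ZMod 2 := fun z => if k ≤ z i then 1 else 0
    let v : (ι → ℤ) → ZMod 2 := fun z => u i z + s z
    have hv : ∀ z, (z i ≤ 0 ∨ k ≤ z i) → v z = 0 := by
      rintro z (h | h)
      · have : ¬ k ≤ z i := by omega
        simp [v, s, h0 _ _ h, this]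
      · simp only [v, s, h1 _ _ h, h, if_true]; exact CharTwo.add_self_eq_zero _
    have hu : ∀ z, u i z = v z + s z := fun z => by
      have := CharTwo.add_self_eq_zero (s z)
      simp only [v]; linear_combination -this
    have hsplit : ∀ z, cupSum u (i :: L) D z =
        (∑ a ∈ D, v (z + Pi.single a 1) * cupSum u L (D.erase a) (z + Pi.single a 1)
          + v z * ∑ a ∈ D, cupSum u L (D.erase a) z)
        + ∑ a ∈ D, (s (z + Pi.single a 1) + s z) * cupSum u L (D.erase a) (z + Pi.single a 1) := by
      intro z
      rw [cupSum_closed u L D z (by rw [hD, List.toFinset_card_of_nodup hL]; simp),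
        Finset.mul_sum, ← Finset.sum_add_distrib, ← Finset.sum_add_distrib, cupSum]
      refine Finset.sum_congr rfl fun a _ => ?_
      rw [hu, hu z]; ring
    rw [Finset.sum_congr rfl fun z _ => hsplit z, Finset.sum_add_distrib, Finset.sum_add_distrib]
    have hA : ∑ z ∈ latticeBox k D c, ∑ a ∈ D, v (z + Pi.single a 1) *
        cupSum u L (D.erase a) (z + Pi.single a 1) =
        ∑ z ∈ latticeBox k D c, v z * ∑ a ∈ D, cupSum u L (D.erase a) z := by
      rw [Finset.sum_comm]
      simp only [Finset.mul_sum]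
      rw [Finset.sum_comm (s := latticeBox k D c)]
      refine Finset.sum_congr rfl fun a ha => ?_
      refine sum_latticeBox_shift ha (fun z => v z * cupSum u L (D.erase a) z) fun z hz => ?_
      by_cases hai : a = i
      · subst hai; simp only [hv z hz, zero_mul]
      · have haL : a ∈ L := by
          have : a ∈ (i :: L) := by rw [← List.mem_toFinset]; exact ha
          simpa [hai] using this
        simp only [cupSum_eq_zero u k h0 h1 a L (D.erase a) z haL (by simp) hz, mul_zero]
    rw [hA, CharTwo.add_self_eq_zero, zero_add]
    have hS : ∀ z, ∑ a ∈ D, (s (z + Pi.single a 1) + s z) *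
        cupSum u L (D.erase a) (z + Pi.single a 1) =
        if z i = k - 1 then cupSum u L L.toFinset (z + Pi.single i 1) else 0 := by
      intro z
      rw [Finset.sum_eq_single_of_mem i hiD, hDi]
      · by_cases hz : z i = k - 1
        · simp [s, hz]
        · have : (k ≤ z i + 1) ↔ k ≤ z i := by omega
          simp only [s, Pi.add_apply, Pi.single_eq_same, this, hz, if_false,
            CharTwo.add_self_eq_zero, zero_mul]
      · intro a _ hai
        have : (z + Pi.single a 1 : ι → ℤ) i = z i := by simp [Ne.symm hai]
        simp only [s, this, CharTwo.add_self_eq_zero, zero_mul]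
    rw [Finset.sum_congr rfl fun z _ => hS z, ← ih (Function.update c i k) (List.nodup_cons.1 hL).2,
      ← Finset.sum_filter]
    refine Finset.sum_bij (fun z _ => z + Pi.single i 1) ?_ ?_ ?_ ?_
    · intro z hz
      rw [Finset.mem_filter, mem_latticeBox] at hz
      rw [mem_latticeBox]
      intro j
      by_cases hji : j = i
      · subst hji; simp [hiL, hz.2]
      · simpa [hji, hD] using hz.1 j
    · intro z _ w _ h
      simpa using h
    · intro z hz
      refine ⟨z - Pi.single i 1, ?_, by simp⟩
      rw [mem_latticeBox] at hz
      rw [Finset.mem_filter, mem_latticeBox]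
      have hzi : z i = k := by simpa using (hz i).2 (by simpa using hiL)
      refine ⟨fun j => ?_, by simp [hzi]⟩
      by_cases hji : j = i
      · subst hji; simp [hzi, hD]; omega
      · simpa [hji, hD] using hz j
    · intros; rfl

/-- **Poincaré–Miranda theorem** on the unit cube. -/
theorem poincare_miranda (F : (ι → ℝ) → ι → ℝ) (hF : Continuous F)
    (hF0 : ∀ x ∈ Icc (0 : ι → ℝ) 1, ∀ i, x i = 0 → 0 ≤ F x i)
    (hF1 : ∀ x ∈ Icc (0 : ι → ℝ) 1, ∀ i, x i = 1 → F x i ≤ 0) :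
    ∃ x ∈ Icc (0 : ι → ℝ) 1, F x = 0 := by
  classical
  have key : ∀ n : ℕ, ∃ x ∈ Icc (0 : ι → ℝ) 1, ∀ i, ∃ p q : ι → ℝ,
      dist p x ≤ 1 / (n + 1) ∧ dist q x ≤ 1 / (n + 1) ∧ F p i ≤ 0 ∧ 0 ≤ F q i := by
    intro n
    let pt : (ι → ℤ) → ι → ℝ := fun z j => max 0 (min 1 (z j / ((n : ℝ) + 1)))
    have hn : (0 : ℝ) < (n : ℝ) + 1 := by positivity
    have hpt : ∀ z, pt z ∈ Icc (0 : ι → ℝ) 1 := fun z =>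
      ⟨fun j => le_max_left _ _, fun j => max_le zero_le_one (min_le_left _ _)⟩
    let u : ι → (ι → ℤ) → ZMod 2 := fun i z =>
      if z i ≤ 0 then 0 else if (n : ℤ) + 1 ≤ z i then 1 else if F (pt z) i ≤ 0 then 1 else 0
    have h0 : ∀ i z, z i ≤ 0 → u i z = 0 := fun i z h => by simp [u, h]
    have h1 : ∀ i z, (n : ℤ) + 1 ≤ z i → u i z = 1 := fun i z h => by
      have : ¬ z i ≤ 0 := by omega
      simp only [u, h, this, if_true, if_false]
    have hu1 : ∀ i z, u i z ≠ 0 → F (pt z) i ≤ 0 := by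
      intro i z h
      by_cases ha : z i ≤ 0
      · exact absurd (h0 i z ha) h
      by_cases hb : (n : ℤ) + 1 ≤ z i
      · refine hF1 _ (hpt z) i ?_
        have : (1 : ℝ) ≤ z i / ((n : ℝ) + 1) := by
          rw [le_div_iff₀ hn]; rw [one_mul]; exact_mod_cast hb
        simp [pt, this]
      · by_contra hc
        exact h (by simp only [u, ha, hb, hc, if_false])
    have hu0 : ∀ i z, u i z ≠ 1 → 0 ≤ F (pt z) i := by
      intro i z h
      by_cases ha : z i ≤ 0
      · refine hF0 _ (hpt z) i ?_
        have : z i / ((n : ℝ) + 1) ≤ 0 :=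
          div_nonpos_of_nonpos_of_nonneg (by exact_mod_cast ha) hn.le
        simp only [pt]
        exact max_eq_left ((min_le_right _ _).trans this)
      by_cases hb : (n : ℤ) + 1 ≤ z i
      · exact absurd (h1 i z hb) h
      · by_contra hc
        exact h (by simp only [u, ha, hb, (not_le.1 hc).le, if_true, if_false])
    have hne := sum_latticeBox_cupSum u (n + 1) (by positivity) h0 h1 Finset.univ.toList 0
      (Finset.nodup_toList _)
    obtain ⟨z, -, hz⟩ := Finset.exists_ne_zero_of_sum_ne_zero (hne.trans_ne one_ne_zero)
    have hdist : ∀ p : ι → ℤ, (∀ j, z j ≤ p j ∧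
        p j ≤ z j + if j ∈ Finset.univ.toList.toFinset then 1 else 0) →
        dist (pt p) (pt z) ≤ 1 / ((n : ℝ) + 1) := by
      intro p hp
      rw [dist_pi_le_iff (by positivity)]
      intro j
      have h2 := hp j
      simp only [Finset.mem_univ, Finset.toList_toFinset, if_true] at h2
      have h3 : |(p j : ℝ) / ((n : ℝ) + 1) - z j / ((n : ℝ) + 1)| ≤ 1 / ((n : ℝ) + 1) := by
        rw [← sub_div, abs_div, abs_of_pos hn]
        gcongr
        rw [abs_le]
        have := h2.1
        have := h2.2
        constructor
        · have : (z j : ℝ) ≤ p j := by exact_mod_cast h2.1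
          linarith
        · have : (p j : ℝ) ≤ z j + 1 := by exact_mod_cast h2.2
          linarith
      rw [Real.dist_eq]
      refine (abs_max_sub_max_le_max _ _ _ _).trans (max_le (by simpa using hn.le) ?_)
      refine (abs_min_sub_min_le_max _ _ _ _).trans (max_le (by simpa using hn.le) h3)
    refine ⟨pt z, hpt z, fun i => ?_⟩
    obtain ⟨p, q, hp, hq, hpq⟩ := exists_of_cupSum_ne_zero u _ _ z hz i (by simp)
    have h01 : ∀ x : ZMod 2, x = 0 ∨ x = 1 := by decide
    rcases h01 (u i p) with h | h
    · exact ⟨pt q, pt p, hdist q hq, hdist p hp, hu1 i q (fun h' => hpq (h.trans h'.symm)),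
        hu0 i p (by rw [h]; decide)⟩
    · exact ⟨pt p, pt q, hdist p hp, hdist q hq, hu1 i p (by rw [h]; decide),
        hu0 i q (fun h' => hpq (h.trans h'.symm))⟩
  choose x hx hx' using key
  obtain ⟨y, hy, φ, hφ, hlim⟩ := (isCompact_Icc (a := (0 : ι → ℝ)) (b := 1)).tendsto_subseq hx
  refine ⟨y, hy, funext fun i => ?_⟩
  choose p q hp hq hFp hFq using fun n => hx' n i
  have hsmall : Tendsto (fun n => 1 / ((φ n : ℝ) + 1)) atTop (𝓝 0) :=
    tendsto_one_div_add_atTop_nhds_zero_nat.comp hφ.tendsto_atTop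
  have hlim' : ∀ r : ℕ → ι → ℝ, (∀ n, dist (r n) (x n) ≤ 1 / (n + 1)) →
      Tendsto (fun n => F (r (φ n)) i) atTop (𝓝 (F y i)) := by
    intro r hr
    have : Tendsto (fun n => r (φ n)) atTop (𝓝 y) := by
      refine hlim.congr_dist ?_
      refine squeeze_zero (fun _ => dist_nonneg) (fun n => ?_) hsmall
      rw [dist_comm]; exact hr (φ n)
    exact (((continuous_apply i).comp hF).tendsto y).comp this
  exact le_antisymm (le_of_tendsto' (hlim' p hp) fun n => hFp _)
    (ge_of_tendsto' (hlim' q hq) fun n => hFq _)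

end PoincareMiranda

section Discrete

/-- Discrete coagulation flux across the level `J`. -/
def discreteFlux (n : ℕ) (w : ℕ → ℕ → ℝ) (m : ℕ → ℝ) (J : ℕ) : ℝ :=
  ∑ k ∈ Finset.range (J + 1), ∑ l ∈ Finset.range (n + 1),
    if J ≤ k + l then w k l * m k * m l else 0

/-- The increments of the largest monotone minorant of a sequence on `{0, …, n}`. -/
def minorantIncrement (n : ℕ) (v : ℕ → ℝ) (k : ℕ) : ℝ :=
  (Finset.range (n + 1)).inf' Finset.nonempty_range_add_one (fun i => v (max k i)) -
    if k = 0 then 0 else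
      (Finset.range (n + 1)).inf' Finset.nonempty_range_add_one (fun i => v (max (k - 1) i))

lemma sum_minorantIncrement (n : ℕ) (v : ℕ → ℝ) (J : ℕ) :
    ∑ k ∈ Finset.range (J + 1), minorantIncrement n v k =
      (Finset.range (n + 1)).inf' Finset.nonempty_range_add_one (fun i => v (max J i)) := by
  induction J with
  | zero => simp [minorantIncrement]
  | succ J ih => rw [Finset.sum_range_succ, ih]; simp [minorantIncrement]

lemma minorantIncrement_nonneg (n : ℕ) (v : ℕ → ℝ) (hv : ∀ j, 0 ≤ v j) (k : ℕ)
    (hkn : k ≤ n) : 0 ≤ minorantIncrement n v k := by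
  unfold minorantIncrement
  split_ifs with hk
  · rw [sub_zero, Finset.le_inf'_iff]
    exact fun i _ => hv _
  · rw [sub_nonneg, Finset.le_inf'_iff]
    intro i hi
    by_cases hik : i ≤ k - 1
    · refine (Finset.inf'_le _ (Finset.mem_range.2 (Nat.lt_succ_of_le hkn))).trans_eq ?_
      congr 1; omega
    · refine (Finset.inf'_le _ hi).trans_eq ?_
      congr 1; omega

lemma discreteFlux_nonneg (n : ℕ) (w : ℕ → ℕ → ℝ) (hw : ∀ k l, 0 ≤ w k l) (m : ℕ → ℝ)
    (hm : ∀ k ≤ n, 0 ≤ m k) (J : ℕ) (hJ : J ≤ n) : 0 ≤ discreteFlux n w m J := by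
  refine Finset.sum_nonneg fun k hk => Finset.sum_nonneg fun l hl => ?_
  rw [Finset.mem_range] at hk hl
  split_ifs
  · exact mul_nonneg (mul_nonneg (hw k l) (hm k (by omega))) (hm l (by omega))
  · exact le_rfl

lemma exists_discrete_solution (n : ℕ) (P : ℕ → ℝ) (hP : ∀ j, 0 < P j) (hmono : Monotone P)
    (w : ℕ → ℕ → ℝ) (hw : ∀ k l, 0 ≤ w k l) (c : ℝ) (hc : 0 ≤ c) :
    ∃ m : ℕ → ℝ, (∀ k ≤ n, 0 ≤ m k) ∧ ∑ k ∈ Finset.range (n + 1), m k = P n ∧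
      (∀ J ≤ n, ∑ k ∈ Finset.range (J + 1), m k ≤ P J) ∧
      ∀ J < n, (∑ k ∈ Finset.range (J + 2), m k) / P (J + 1) -
        (∑ k ∈ Finset.range (J + 1), m k) / P J =
          c * (1 / P J - 1 / P (J + 1)) * discreteFlux n w m J := by
  let v : (Fin n → ℝ) → ℕ → ℝ := fun u j => if h : j < n then u ⟨j, h⟩ * P j else P j
  have hvc : ∀ j, Continuous fun u => v u j := by
    intro j
    by_cases h : j < n
    · simp only [v, h, dif_pos]; fun_prop
    · simp only [v, h, dif_neg, not_false_eq_true]; fun_prop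
  have hmc : ∀ k, Continuous fun u => minorantIncrement n (v u) k := by
    intro k
    unfold minorantIncrement
    refine Continuous.sub (Continuous.finset_inf'_apply _ fun i _ => hvc _) ?_
    split_ifs
    · exact continuous_const
    · exact Continuous.finset_inf'_apply _ fun i _ => hvc _
  have hv0 : ∀ u ∈ Icc (0 : Fin n → ℝ) 1, ∀ j, 0 ≤ v u j := by
    intro u hu j
    simp only [v]
    split_ifs with h
    · exact mul_nonneg (hu.1 _) (hP j).le
    · exact (hP j).le
  have hv1 : ∀ u ∈ Icc (0 : Fin n → ℝ) 1, ∀ j, v u j ≤ P j := by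
    intro u hu j
    simp only [v]
    split_ifs with h
    · exact mul_le_of_le_one_left (hP j).le (hu.2 _)
    · exact le_rfl
  have hcoef : ∀ J, 0 ≤ c * (1 / P J - 1 / P (J + 1)) := fun J =>
    mul_nonneg hc (sub_nonneg.2 (one_div_le_one_div_of_le (hP J) (hmono J.le_succ)))
  let F : (Fin n → ℝ) → Fin n → ℝ := fun u J =>
    v u (J + 1) / P (J + 1) - u J -
      c * (1 / P J - 1 / P (J + 1)) * discreteFlux n w (minorantIncrement n (v u)) J
  have hF : Continuous F := by
    refine continuous_pi fun J => ?_
    refine ((hvc _).div_const _ |>.sub (continuous_apply J)).sub (continuous_const.mul ?_)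
    unfold discreteFlux
    refine continuous_finsetSum _ fun k _ => continuous_finsetSum _ fun l _ => ?_
    split_ifs
    · exact (continuous_const.mul (hmc k)).mul (hmc l)
    · exact continuous_const
  have hF0 : ∀ u ∈ Icc (0 : Fin n → ℝ) 1, ∀ J, u J = 0 → 0 ≤ F u J := by
    intro u hu J hJ
    have hflux : discreteFlux n w (minorantIncrement n (v u)) J = 0 := by
      have hz : ∀ k ∈ Finset.range ((J : ℕ) + 1), minorantIncrement n (v u) k = 0 := by
        refine (Finset.sum_eq_zero_iff_of_nonneg fun k hk => ?_).1 ?_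
        · rw [Finset.mem_range] at hk
          exact minorantIncrement_nonneg n _ (hv0 u hu) k (by omega)
        · rw [sum_minorantIncrement]
          refine le_antisymm ((Finset.inf'_le _
            (Finset.mem_range.2 (Nat.lt_succ_of_lt J.2))).trans_eq ?_) ?_
          · simp [v, hJ]
          · rw [Finset.le_inf'_iff]
            exact fun i _ => hv0 u hu _
      refine Finset.sum_eq_zero fun k hk => Finset.sum_eq_zero fun l _ => ?_
      simp [hz k hk]
    simp only [F, hflux, hJ, mul_zero, sub_zero]
    exact div_nonneg (hv0 u hu _) (hP _).le
  have hF1 : ∀ u ∈ Icc (0 : Fin n → ℝ) 1, ∀ J, u J = 1 → F u J ≤ 0 := by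
    intro u hu J hJ
    have h1 : v u (J + 1) / P (J + 1) ≤ 1 := (div_le_one (hP _)).2 (hv1 u hu _)
    have h2 := mul_nonneg (hcoef J) (discreteFlux_nonneg n w hw _
      (fun k hk => minorantIncrement_nonneg n _ (hv0 u hu) k hk) J J.2.le)
    simp only [F, hJ]
    linarith
  obtain ⟨u, hu, hFu⟩ := poincare_miranda F hF hF0 hF1
  have heq : ∀ J (h : J < n), v u (J + 1) / P (J + 1) - v u J / P J =
      c * (1 / P J - 1 / P (J + 1)) * discreteFlux n w (minorantIncrement n (v u)) J := by
    intro J h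
    have h1 := congrFun hFu ⟨J, h⟩
    have h2 : v u J / P J = u ⟨J, h⟩ := by
      simp only [v, h, dif_pos]; field_simp [(hP J).ne']
    simp only [F, Pi.zero_apply] at h1
    rw [h2]; linarith
  have hstep : ∀ J < n, v u J ≤ v u (J + 1) := by
    intro J h
    have h1 : v u J / P J ≤ v u (J + 1) / P (J + 1) := by
      rw [← sub_nonneg, heq J h]
      exact mul_nonneg (hcoef J) (discreteFlux_nonneg n w hw _
        (fun k hk => minorantIncrement_nonneg n _ (hv0 u hu) k hk) J h.le)
    calc v u J = v u J / P J * P J := by field_simp [(hP J).ne']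
      _ ≤ v u (J + 1) / P (J + 1) * P (J + 1) :=
        mul_le_mul h1 (hmono J.le_succ) (hP J).le (div_nonneg (hv0 u hu _) (hP _).le)
      _ = v u (J + 1) := by field_simp [(hP (J + 1)).ne']
  have hvm : ∀ J i, J ≤ i → i ≤ n → v u J ≤ v u i := by
    intro J i hJi
    induction i, hJi using Nat.le_induction with
    | base => exact fun _ => le_rfl
    | succ i _ ih => exact fun h => (ih (by omega)).trans (hstep i (by omega))
  have hsum : ∀ J ≤ n, ∑ k ∈ Finset.range (J + 1), minorantIncrement n (v u) k = v u J := by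
    intro J hJ
    rw [sum_minorantIncrement]
    refine le_antisymm ?_ ?_
    · refine (Finset.inf'_le _ (Finset.mem_range.2 (Nat.lt_succ_of_le hJ))).trans_eq ?_
      rw [max_self]
    · rw [Finset.le_inf'_iff]
      intro i hi
      rw [Finset.mem_range] at hi
      exact hvm _ _ (le_max_left _ _) (max_le hJ (by omega))
  refine ⟨minorantIncrement n (v u), minorantIncrement_nonneg n _ (hv0 u hu), ?_, ?_, ?_⟩
  · rw [hsum n le_rfl]; simp [v]
  · intro J hJ; rw [hsum J hJ]; exact hv1 u hu J
  · intro J hJ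
    rw [hsum J hJ.le, hsum (J + 1) hJ, heq J hJ]

end Discrete

section Moments

/-- Nonnegative measures on `(0, ∞)` whose mass on `[0, R]` is at most `R ^ (1 - ρ)`. -/
structure MassBound (ρ : ℝ) (μ : Measure ℝ) : Prop where
  null : μ (Iic 0) = 0
  le : ∀ R > (0 : ℝ), μ (Icc 0 R) ≤ ENNReal.ofReal (R ^ (1 - ρ))

lemma lintegral_Ioi_rpow {a c : ℝ} (ha : a < -1) (hc : 0 < c) :
    ∫⁻ r in Ioi c, ENNReal.ofReal (r ^ a) = ENNReal.ofReal (-c ^ (a + 1) / (a + 1)) := by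
  rw [← integral_Ioi_rpow_of_lt ha hc, ofReal_integral_eq_lintegral_ofReal]
  · exact integrableOn_Ioi_rpow_of_lt ha hc
  · filter_upwards [ae_restrict_mem measurableSet_Ioi] with r hr
    exact rpow_nonneg (hc.trans hr).le _

variable {ρ : ℝ} {μ : Measure ℝ}

lemma MassBound.sigmaFinite (h : MassBound ρ μ) : SigmaFinite μ := by
  refine ⟨⟨⟨fun n => Iic (n : ℝ), fun _ => trivial, fun n => ?_, ?_⟩⟩⟩
  · have hsub : Iic (n : ℝ) ⊆ Iic 0 ∪ Icc 0 ((n : ℝ) + 1) := fun x hx => by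
      rcases le_total x 0 with h0 | h0
      · exact Or.inl h0
      · exact Or.inr ⟨h0, (mem_Iic.1 hx).trans (by linarith)⟩
    refine (measure_mono hsub).trans_lt ((measure_union_le _ _).trans_lt ?_)
    rw [h.null, zero_add]
    exact (h.le _ (by positivity)).trans_lt ENNReal.ofReal_lt_top
  · refine eq_univ_of_forall fun x => mem_iUnion.2 ?_
    exact (exists_nat_ge x)

lemma MassBound.ae_pos (h : MassBound ρ μ) : ∀ᵐ x ∂μ, 0 < x := by
  rw [ae_iff]
  simpa [not_lt, Iic] using h.null

lemma MassBound.restrict_eq (h : MassBound ρ μ) : μ.restrict (Ioi 0) = μ :=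
  Measure.restrict_eq_self_of_ae_mem h.ae_pos

lemma MassBound.lintegral_tail (h : MassBound ρ μ) {γ s : ℝ} (hγρ : γ < ρ) (hρ : ρ < 1)
    (hs : 0 < s) :
    ∫⁻ z in Ici s, ENNReal.ofReal (z ^ (γ - 1)) ∂μ ≤
      ENNReal.ofReal ((1 - γ) / (ρ - γ) * s ^ (γ - ρ)) := by
  have := h.sigmaFinite
  have hγ1 : 0 < 1 - γ := by linarith
  let f : ℝ → ℝ → ENNReal := fun z r =>
    (Ici z).indicator (fun r => ENNReal.ofReal (1 - γ) * ENNReal.ofReal (r ^ (γ - 2))) r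
  have hfm : Measurable (Function.uncurry f) := by
    have : Function.uncurry f = {p : ℝ × ℝ | p.1 ≤ p.2}.indicator
        (fun p => ENNReal.ofReal (1 - γ) * ENNReal.ofReal (p.2 ^ (γ - 2))) := by
      ext ⟨z, r⟩
      simp [f, Function.uncurry, indicator]
    rw [this]
    refine Measurable.indicator (by fun_prop) (measurableSet_le measurable_fst measurable_snd)
  have h1 : ∫⁻ z in Ici s, ENNReal.ofReal (z ^ (γ - 1)) ∂μ =
      ∫⁻ z in Ici s, ∫⁻ r in Ioi s, f z r ∂volume ∂μ := by
    refine setLIntegral_congr_fun measurableSet_Ici fun z hz => ?_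
    have hz0 : 0 < z := hs.trans_le hz
    have e1 : ∫⁻ r in Ioi s, f z r = ∫⁻ r in Ioi z,
        ENNReal.ofReal (1 - γ) * ENNReal.ofReal (r ^ (γ - 2)) := by
      rw [setLIntegral_congr (Ioi_ae_eq_Ici' (a := s) (by simp))]
      simp only [f]
      rw [lintegral_indicator measurableSet_Ici, Measure.restrict_restrict measurableSet_Ici,
        inter_eq_left.2 (Ici_subset_Ici.2 hz), ← setLIntegral_congr Ioi_ae_eq_Ici]
    rw [e1, lintegral_const_mul _ (by fun_prop), lintegral_Ioi_rpow (by linarith) hz0,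
      ← ENNReal.ofReal_mul hγ1.le]
    congr 1
    rw [show γ - 2 + 1 = -(1 - γ) by ring, show γ - 1 = -(1 - γ) by ring]
    field_simp
  rw [h1, lintegral_lintegral_swap hfm.aemeasurable]
  have h2 : ∀ r ∈ Ioi s, ∫⁻ z in Ici s, f z r ∂μ ≤
      ENNReal.ofReal (1 - γ) * ENNReal.ofReal (r ^ (γ - ρ - 1)) := by
    intro r hr
    have hr0 : 0 < r := hs.trans hr
    have : ∀ z, f z r = (Iic r).indicator
        (fun _ => ENNReal.ofReal (1 - γ) * ENNReal.ofReal (r ^ (γ - 2))) z := by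
      intro z; simp [f, indicator]
    simp only [this]
    rw [lintegral_indicator measurableSet_Iic, setLIntegral_const,
      Measure.restrict_apply measurableSet_Iic, mul_assoc]
    gcongr
    have hsub : Iic r ∩ Ici s ⊆ Icc 0 r := fun x hx => ⟨hs.le.trans hx.2, hx.1⟩
    calc ENNReal.ofReal (r ^ (γ - 2)) * μ (Iic r ∩ Ici s)
        ≤ ENNReal.ofReal (r ^ (γ - 2)) * ENNReal.ofReal (r ^ (1 - ρ)) := by
          gcongr; exact (measure_mono hsub).trans (h.le r hr0)
      _ = _ := by
          rw [← ENNReal.ofReal_mul (by positivity), ← rpow_add hr0]; congr 2; ring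
  refine (setLIntegral_mono (by fun_prop) h2).trans_eq ?_
  rw [lintegral_const_mul _ (by fun_prop), lintegral_Ioi_rpow (by linarith) hs,
    ← ENNReal.ofReal_mul hγ1.le]
  congr 1
  rw [show γ - ρ - 1 + 1 = -(ρ - γ) by ring, show γ - ρ = -(ρ - γ) by ring]
  have : ρ - γ ≠ 0 := by linarith
  field_simp

lemma MassBound.lintegral_Ioc_const (h : MassBound ρ μ) {s c : ℝ} (hs : 0 < s) (hc : 0 ≤ c)
    {f : ℝ → ℝ} (hf : ∀ z ∈ Ioc 0 s, f z ≤ c) :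
    ∫⁻ z in Ioc 0 s, ENNReal.ofReal (f z) ∂μ ≤ ENNReal.ofReal (c * s ^ (1 - ρ)) := by
  calc ∫⁻ z in Ioc 0 s, ENNReal.ofReal (f z) ∂μ ≤ ∫⁻ z in Ioc 0 s, ENNReal.ofReal c ∂μ :=
        setLIntegral_mono measurable_const fun z hz => ENNReal.ofReal_le_ofReal (hf z hz)
    _ = ENNReal.ofReal c * μ (Ioc 0 s) := setLIntegral_const _ _
    _ ≤ ENNReal.ofReal c * ENNReal.ofReal (s ^ (1 - ρ)) := by
        gcongr; exact (measure_mono Ioc_subset_Icc_self).trans (h.le s hs)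
    _ = _ := (ENNReal.ofReal_mul hc).symm

lemma setLIntegral_Ioi_le_add (μ : Measure ℝ) (s : ℝ) (f : ℝ → ENNReal) :
    ∫⁻ z in Ioi 0, f z ∂μ ≤ ∫⁻ z in Ioc 0 s, f z ∂μ + ∫⁻ z in Ici s, f z ∂μ := by
  refine (lintegral_mono_set fun x hx => ?_).trans (lintegral_union_le _ _ _)
  rcases le_total x s with h | h
  · exact Or.inl ⟨hx, h⟩
  · exact Or.inr h

lemma MassBound.lintegral_rpow_min (h : MassBound ρ μ) {γ s : ℝ} (hγ : 0 ≤ γ) (hγρ : γ < ρ)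
    (hρ : ρ < 1) (hs : 0 < s) :
    ∫⁻ z in Ioi 0, ENNReal.ofReal (z ^ γ * min 1 (s / z)) ∂μ ≤
      ENNReal.ofReal ((1 + (1 - γ) / (ρ - γ)) * s ^ (1 - ρ + γ)) := by
  have hq : 0 ≤ (1 - γ) / (ρ - γ) := div_nonneg (by linarith) (by linarith)
  refine (setLIntegral_Ioi_le_add μ s _).trans ?_
  have h1 : ∫⁻ z in Ioc 0 s, ENNReal.ofReal (z ^ γ * min 1 (s / z)) ∂μ ≤
      ENNReal.ofReal (s ^ γ * s ^ (1 - ρ)) := by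
    refine h.lintegral_Ioc_const hs (by positivity) fun z hz => ?_
    exact (mul_le_of_le_one_right (rpow_nonneg hz.1.le _) (min_le_left _ _)).trans
      (rpow_le_rpow hz.1.le hz.2 hγ)
  have h2 : ∫⁻ z in Ici s, ENNReal.ofReal (z ^ γ * min 1 (s / z)) ∂μ ≤
      ENNReal.ofReal (s * ((1 - γ) / (ρ - γ) * s ^ (γ - ρ))) := by
    calc _ ≤ ∫⁻ z in Ici s, ENNReal.ofReal s * ENNReal.ofReal (z ^ (γ - 1)) ∂μ := by
          refine setLIntegral_mono (by fun_prop) fun z hz => ?_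
          have hz0 : 0 < z := hs.trans_le hz
          rw [← ENNReal.ofReal_mul hs.le]
          refine ENNReal.ofReal_le_ofReal ?_
          calc z ^ γ * min 1 (s / z) ≤ z ^ γ * (s / z) := by
                gcongr; exact min_le_right _ _
            _ = s * z ^ (γ - 1) := by rw [rpow_sub_one hz0.ne']; ring
      _ = ENNReal.ofReal s * ∫⁻ z in Ici s, ENNReal.ofReal (z ^ (γ - 1)) ∂μ :=
          lintegral_const_mul _ (by fun_prop)
      _ ≤ _ := by
          rw [ENNReal.ofReal_mul hs.le]; gcongr; exact h.lintegral_tail hγρ hρ hs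
  refine (add_le_add h1 h2).trans_eq ?_
  rw [← ENNReal.ofReal_add (by positivity) (by positivity)]
  congr 1
  rw [← rpow_add hs, add_mul, one_mul, add_comm γ]
  congr 1
  rw [show 1 - ρ + γ = 1 + (γ - ρ) by ring, rpow_add hs, rpow_one]; ring

/-- A common constant for the moment bounds. -/
def momentConst (γ ρ : ℝ) : ℝ := (1 + 1 / ρ) + (1 + (1 - γ) / (ρ - γ))

lemma one_le_momentConst {γ ρ : ℝ} (hγ : 0 ≤ γ) (hγρ : γ < ρ) (hρ : ρ < 1) :
    1 ≤ momentConst γ ρ := by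
  have h1 : 0 ≤ (1 - γ) / (ρ - γ) := div_nonneg (by linarith) (by linarith)
  have h2 : 0 ≤ 1 / ρ := div_nonneg zero_le_one (by linarith)
  unfold momentConst; linarith

lemma MassBound.lintegral_kernel_min (h : MassBound ρ μ) {γ s y : ℝ} (hγ : 0 ≤ γ) (hγρ : γ < ρ)
    (hρ : ρ < 1) (hy : 0 < y) (hys : y ≤ s) :
    ∫⁻ z in Ioi 0, ENNReal.ofReal ((y ^ γ + z ^ γ) * min 1 (s / z)) ∂μ ≤
      ENNReal.ofReal (momentConst γ ρ * s ^ (1 - ρ + γ)) := by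
  have hs : 0 < s := hy.trans_le hys
  have h0 := h.lintegral_rpow_min le_rfl (hγ.trans_lt hγρ) hρ hs
  simp only [rpow_zero, one_mul, sub_zero, add_zero] at h0
  have hq : 0 ≤ (1 - γ) / (ρ - γ) := div_nonneg (by linarith) (by linarith)
  have hρ0 : 0 < ρ := hγ.trans_lt hγρ
  have hq' : 0 ≤ 1 / ρ := by positivity
  calc _ ≤ ∫⁻ z in Ioi 0, (ENNReal.ofReal (s ^ γ) * ENNReal.ofReal (min 1 (s / z)) +
          ENNReal.ofReal (z ^ γ * min 1 (s / z))) ∂μ := by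
        refine setLIntegral_mono (by fun_prop) fun z hz => ?_
        have hz0 : 0 < z := hz
        have hm : 0 ≤ min 1 (s / z) := le_min zero_le_one (by positivity)
        rw [← ENNReal.ofReal_mul (by positivity), ← ENNReal.ofReal_add (by positivity)
          (by positivity), ← add_mul]
        refine ENNReal.ofReal_le_ofReal ?_
        gcongr
    _ = ENNReal.ofReal (s ^ γ) * ∫⁻ z in Ioi 0, ENNReal.ofReal (min 1 (s / z)) ∂μ +
          ∫⁻ z in Ioi 0, ENNReal.ofReal (z ^ γ * min 1 (s / z)) ∂μ := by
        rw [lintegral_add_left (by fun_prop), lintegral_const_mul _ (by fun_prop)]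
    _ ≤ ENNReal.ofReal (s ^ γ) * ENNReal.ofReal ((1 + 1 / ρ) * s ^ (1 - ρ)) +
          ENNReal.ofReal ((1 + (1 - γ) / (ρ - γ)) * s ^ (1 - ρ + γ)) := by
        gcongr
        exact h.lintegral_rpow_min hγ hγρ hρ hs
    _ = _ := by
        rw [← ENNReal.ofReal_mul (by positivity), ← ENNReal.ofReal_add (by positivity)
          (by positivity)]
        congr 1
        rw [rpow_add hs, momentConst]; ring

lemma MassBound.lintegral_flux_tail (h : MassBound ρ μ) {γ R : ℝ} (hγ : 0 ≤ γ) (hγρ : γ < ρ)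
    (hρ : ρ < 1) (hR : 0 < R) :
    ∫⁻ y in Ioi 0, ∫⁻ z in Ioi 0, ENNReal.ofReal
        (max R y ^ (ρ - 2) * ((y ^ γ + z ^ γ) * min 1 (max R y / z))) ∂μ ∂μ ≤
      ENNReal.ofReal (momentConst γ ρ ^ 2 * R ^ (γ - ρ)) := by
  have hA := one_le_momentConst hγ hγρ hρ
  have hq' : 0 ≤ 1 / ρ := by have := hγ.trans_lt hγρ; positivity
  have hq : 0 ≤ (1 - γ) / (ρ - γ) := div_nonneg (by linarith) (by linarith)
  have h1 : ∀ y ∈ Ioi (0 : ℝ), ∫⁻ z in Ioi 0, ENNReal.ofReal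
        (max R y ^ (ρ - 2) * ((y ^ γ + z ^ γ) * min 1 (max R y / z))) ∂μ ≤
      ENNReal.ofReal (momentConst γ ρ) * ENNReal.ofReal (max R y ^ (γ - 1)) := by
    intro y hy
    have hs : 0 < max R y := lt_max_of_lt_left hR
    simp only [ENNReal.ofReal_mul (rpow_nonneg hs.le (ρ - 2))]
    rw [lintegral_const_mul _ (by fun_prop)]
    refine (mul_le_mul_right (h.lintegral_kernel_min hγ hγρ hρ hy (le_max_right R y)) _).trans_eq ?_
    rw [← ENNReal.ofReal_mul (by positivity), ← ENNReal.ofReal_mul (by positivity)]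
    congr 1
    rw [show max R y ^ (γ - 1) = max R y ^ (ρ - 2) * max R y ^ (1 - ρ + γ) by
      rw [← rpow_add hs]; congr 1; ring]
    ring
  refine (setLIntegral_mono (by fun_prop) h1).trans ?_
  rw [lintegral_const_mul _ (by fun_prop), sq, mul_assoc, ENNReal.ofReal_mul (by positivity)]
  gcongr
  refine (setLIntegral_Ioi_le_add μ R _).trans ?_
  have h2 : ∫⁻ y in Ioc 0 R, ENNReal.ofReal (max R y ^ (γ - 1)) ∂μ ≤
      ENNReal.ofReal (R ^ (γ - 1) * R ^ (1 - ρ)) :=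
    h.lintegral_Ioc_const hR (by positivity) fun y hy => by rw [max_eq_left hy.2]
  have h3 : ∫⁻ y in Ici R, ENNReal.ofReal (max R y ^ (γ - 1)) ∂μ ≤
      ENNReal.ofReal ((1 - γ) / (ρ - γ) * R ^ (γ - ρ)) := by
    refine le_trans (le_of_eq ?_) (h.lintegral_tail hγρ hρ hR)
    exact setLIntegral_congr_fun measurableSet_Ici fun y hy => by
      simp only [max_eq_right (mem_Ici.1 hy)]
  refine (add_le_add h2 h3).trans ?_
  rw [← ENNReal.ofReal_add (by positivity) (by positivity), ← rpow_add hR]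
  refine ENNReal.ofReal_le_ofReal ?_
  rw [show γ - 1 + (1 - ρ) = γ - ρ by ring, momentConst]
  nlinarith [rpow_pos_of_pos hR (γ - ρ)]

end Moments

section Grid

/-- The atomic measure with masses `m j` at the grid points `(j + 1) * ε`, `j ≤ n`. -/
def gridMeasure (ε : ℝ) (n : ℕ) (m : ℕ → ℝ) : Measure ℝ :=
  ∑ j ∈ Finset.range (n + 1), ENNReal.ofReal (m j) • Measure.dirac (((j : ℝ) + 1) * ε)

variable {ε : ℝ} {n : ℕ} {m : ℕ → ℝ}

instance : IsFiniteMeasure (gridMeasure ε n m) := by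
  refine ⟨?_⟩
  simp [gridMeasure, ENNReal.sum_lt_top, Measure.finsetSum_apply]

lemma lintegral_gridMeasure (f : ℝ → ENNReal) :
    ∫⁻ x, f x ∂gridMeasure ε n m =
      ∑ j ∈ Finset.range (n + 1), ENNReal.ofReal (m j) * f (((j : ℝ) + 1) * ε) := by
  simp [gridMeasure]

lemma integral_gridMeasure (hm : ∀ j ≤ n, 0 ≤ m j) (f : ℝ → ℝ) :
    ∫ x, f x ∂gridMeasure ε n m =
      ∑ j ∈ Finset.range (n + 1), m j * f (((j : ℝ) + 1) * ε) := by
  unfold gridMeasure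
  rw [integral_finsetSum_measure]
  · refine Finset.sum_congr rfl fun j hj => ?_
    rw [integral_smul_measure, integral_dirac,
      ENNReal.toReal_ofReal (hm j (by simpa [Nat.lt_succ_iff] using hj)), smul_eq_mul]
  · exact fun j _ => (integrable_dirac (by simp)).smul_measure ENNReal.ofReal_ne_top

lemma gridMeasure_apply {s : Set ℝ} (hs : MeasurableSet s) :
    gridMeasure ε n m s = ∑ j ∈ Finset.range (n + 1),
      ENNReal.ofReal (m j) * s.indicator 1 (((j : ℝ) + 1) * ε) := by
  rw [← lintegral_indicator_one hs, lintegral_gridMeasure]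

lemma gridMeasure_Icc_ge (hε : 0 < ε) (hm : ∀ j ≤ n, 0 ≤ m j) {J : ℕ} (hJ : J ≤ n) {R : ℝ}
    (hR : ((J : ℝ) + 1) * ε ≤ R) :
    ENNReal.ofReal (∑ j ∈ Finset.range (J + 1), m j) ≤ gridMeasure ε n m (Icc 0 R) := by
  rw [gridMeasure_apply measurableSet_Icc, ENNReal.ofReal_sum_of_nonneg fun j hj =>
    hm j (by have := Finset.mem_range.1 hj; omega)]
  refine (Finset.sum_le_sum fun j hj => ?_).trans
    (Finset.sum_le_sum_of_subset (Finset.range_subset_range.2 (Nat.succ_le_succ hJ)))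
  have hjJ : (j : ℝ) ≤ J := by exact_mod_cast Nat.lt_succ_iff.1 (Finset.mem_range.1 hj)
  rw [indicator_of_mem]
  · simp
  · refine ⟨by positivity, le_trans ?_ hR⟩
    gcongr

lemma massBound_gridMeasure {ρ : ℝ} (hρ : ρ < 1) (hε : 0 < ε) (hm : ∀ j ≤ n, 0 ≤ m j)
    (hM : ∀ J ≤ n, ∑ j ∈ Finset.range (J + 1), m j ≤ (((J : ℝ) + 1) * ε) ^ (1 - ρ)) :
    MassBound ρ (gridMeasure ε n m) := by
  refine ⟨?_, fun R hR => ?_⟩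
  · rw [gridMeasure_apply measurableSet_Iic]
    refine Finset.sum_eq_zero fun j _ => ?_
    rw [indicator_of_notMem, mul_zero]
    rw [mem_Iic, not_le]; positivity
  · rw [gridMeasure_apply measurableSet_Icc]
    rcases lt_or_ge R ε with h | h
    · refine (Finset.sum_eq_zero fun j _ => ?_).trans_le zero_le
      rw [indicator_of_notMem, mul_zero]
      rintro ⟨-, h'⟩
      have : (0 : ℝ) ≤ j := j.cast_nonneg
      nlinarith
    · have hfl : 1 ≤ ⌊R / ε⌋₊ := Nat.le_floor (by simpa using (one_le_div hε).2 h)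
      set J := min n (⌊R / ε⌋₊ - 1) with hJ
      have hJn : J ≤ n := min_le_left _ _
      have hJR : ((J : ℝ) + 1) * ε ≤ R := by
        have h1 : ((J + 1 : ℕ) : ℝ) ≤ R / ε :=
          le_trans (by exact_mod_cast (by omega)) (Nat.floor_le (a := R / ε) (by positivity))
        rw [le_div_iff₀ hε] at h1
        exact_mod_cast h1
      calc _ ≤ ∑ j ∈ Finset.range (J + 1), ENNReal.ofReal (m j) := by
            rw [← Finset.sum_subset (Finset.range_subset_range.2 (Nat.succ_le_succ hJn))]
            · exact Finset.sum_le_sum fun j _ =>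
                mul_le_of_le_one_right' (indicator_le (fun _ _ => le_rfl) _)
            · intro j hj hj'
              rw [indicator_of_notMem, mul_zero]
              rintro ⟨-, h'⟩
              rw [← le_div_iff₀ hε] at h'
              have : j + 1 ≤ ⌊R / ε⌋₊ := Nat.le_floor (by exact_mod_cast h')
              rw [Finset.mem_range] at hj hj'
              omega
        _ = ENNReal.ofReal (∑ j ∈ Finset.range (J + 1), m j) :=
            (ENNReal.ofReal_sum_of_nonneg fun j hj =>
              hm j (by have := Finset.mem_range.1 hj; omega)).symm
        _ ≤ _ := ENNReal.ofReal_le_ofReal ((hM J hJn).trans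
            (rpow_le_rpow (by positivity) hJR (by linarith)))

lemma sum_mul_discreteFlux (n : ℕ) (w : ℕ → ℕ → ℝ) (m g : ℕ → ℝ) :
    ∑ i ∈ Finset.range n, g i * discreteFlux n w m i =
      ∑ k ∈ Finset.range (n + 1), ∑ l ∈ Finset.range (n + 1), m k * m l * (w k l *
        ∑ i ∈ Finset.range n, if k ≤ i ∧ i ≤ k + l then g i else 0) := by
  have h : ∀ i ∈ Finset.range n, g i * discreteFlux n w m i =
      ∑ k ∈ Finset.range (n + 1), ∑ l ∈ Finset.range (n + 1), m k * m l * (w k l *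
        if k ≤ i ∧ i ≤ k + l then g i else 0) := by
    intro i hi
    rw [discreteFlux, Finset.mul_sum]
    have hi' : i + 1 ≤ n + 1 := Nat.succ_le_succ (Finset.mem_range.1 hi).le
    rw [← Finset.sum_subset (Finset.range_subset_range.2 hi')]
    · refine Finset.sum_congr rfl fun k hk => ?_
      rw [Finset.mul_sum]
      refine Finset.sum_congr rfl fun l _ => ?_
      have : k ≤ i := Nat.lt_succ_iff.1 (Finset.mem_range.1 hk)
      by_cases h' : i ≤ k + l
      · simp only [h', this, and_self, if_true]; ring
      · simp [h']
    · intro k _ hk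
      refine Finset.sum_eq_zero fun l _ => ?_
      rw [if_neg, mul_zero, mul_zero]
      rw [Finset.mem_range] at hk
      omega
  rw [Finset.sum_congr rfl h, Finset.sum_comm]
  refine Finset.sum_congr rfl fun k _ => ?_
  rw [Finset.sum_comm]
  refine Finset.sum_congr rfl fun l _ => ?_
  rw [Finset.mul_sum, Finset.mul_sum]

lemma rpow_sub_rpow_div_le {ρ s y z : ℝ} (hρ0 : 0 < ρ) (hρ : ρ < 1) (hy : 0 < y) (hz : 0 < z)
    (hys : y ≤ s) :
    (s ^ (ρ - 1) - (y + z) ^ (ρ - 1)) / z ≤ s ^ (ρ - 2) * min 1 (s / z) := by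
  have hs : 0 < s := hy.trans_le hys
  have e : s ^ (ρ - 1) = s ^ (ρ - 2) * s := by
    rw [← rpow_add_one hs.ne']; congr 1; ring
  rw [mul_min_of_nonneg _ _ (by positivity)]
  refine le_min ?_ ?_
  · rw [mul_one, div_le_iff₀ hz]
    have h1 : (s + z) ^ (ρ - 1) ≤ (y + z) ^ (ρ - 1) :=
      rpow_le_rpow_of_nonpos (by positivity) (by linarith) (by linarith)
    have h2 : s ^ (ρ - 1) - s ^ (ρ - 2) * z ≤ (s + z) ^ (ρ - 1) := by
      rw [show s + z = s * (1 + z / s) by field_simp, mul_rpow hs.le (by positivity)]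
      have h3 : 1 - z / s ≤ (1 + z / s) ^ (ρ - 1) := by
        have h4 : (1 + z / s) ^ (-1 : ℝ) ≤ (1 + z / s) ^ (ρ - 1) :=
          rpow_le_rpow_of_exponent_le (by simp; positivity) (by linarith)
        refine le_trans ?_ h4
        rw [rpow_neg_one, ← one_div, le_div_iff₀ (by positivity)]
        nlinarith [sq_nonneg (z / s)]
      calc s ^ (ρ - 1) - s ^ (ρ - 2) * z = s ^ (ρ - 1) * (1 - z / s) := by
            rw [e]; field_simp
        _ ≤ _ := by gcongr
    linarith
  · rw [← mul_div_assoc, ← e]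
    have : 0 ≤ (y + z) ^ (ρ - 1) := by positivity
    gcongr; linarith

end Grid

section Approximants

variable {γ C ρ ε : ℝ} {K : ℝ → ℝ → ℝ} {n : ℕ} {m : ℕ → ℝ}

lemma sum_Ico_sub_succ (e : ℕ → ℝ) {a b : ℕ} (hab : a ≤ b) :
    ∑ i ∈ Finset.Ico a b, (e i - e (i + 1)) = e a - e b := by
  induction b, hab using Nat.le_induction with
  | base => simp
  | succ b hab ih => rw [Finset.sum_Ico_succ_top hab, ih]; ring

lemma sum_range_sub_mul_sum (p m : ℕ → ℝ) (n : ℕ) :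
    ∑ J ∈ Finset.range n, (p (J + 1) - p J) * ∑ k ∈ Finset.range (J + 1), m k =
      ∑ k ∈ Finset.range (n + 1), m k * (p n - p k) := by
  induction n with
  | zero => simp
  | succ n ih =>
    rw [Finset.sum_range_succ, ih, Finset.sum_range_succ _ (n + 1), sub_self, mul_zero, add_zero,
      Finset.mul_sum, ← Finset.sum_add_distrib]
    exact Finset.sum_congr rfl fun k _ => by ring

lemma gridMeasure_double_sum_le (hm : ∀ j ≤ n, 0 ≤ m j) (h : MassBound ρ (gridMeasure ε n m))
    (hγ : 0 ≤ γ) (hγρ : γ < ρ) (hρ : ρ < 1) (hε : 0 < ε) {R : ℝ} (hR : 0 < R) :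
    ∑ k ∈ Finset.range (n + 1), ∑ l ∈ Finset.range (n + 1), m k * m l *
      (max R (((k : ℝ) + 1) * ε) ^ (ρ - 2) * (((((k : ℝ) + 1) * ε) ^ γ + (((l : ℝ) + 1) * ε) ^ γ) *
        min 1 (max R (((k : ℝ) + 1) * ε) / (((l : ℝ) + 1) * ε)))) ≤
      momentConst γ ρ ^ 2 * R ^ (γ - ρ) := by
  have hA := one_le_momentConst hγ hγρ hρ
  have := h.lintegral_flux_tail hγ hγρ hρ hR
  rw [h.restrict_eq, lintegral_gridMeasure] at this
  simp only [lintegral_gridMeasure] at this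
  rw [← ENNReal.ofReal_le_ofReal_iff (by positivity)]
  refine le_trans (le_of_eq ?_) this
  have hm' : ∀ j ∈ Finset.range (n + 1), 0 ≤ m j := fun j hj =>
    hm j (Nat.lt_succ_iff.1 (Finset.mem_range.1 hj))
  have hF : ∀ k l : ℕ, 0 ≤ max R (((k : ℝ) + 1) * ε) ^ (ρ - 2) *
      (((((k : ℝ) + 1) * ε) ^ γ + (((l : ℝ) + 1) * ε) ^ γ) *
        min 1 (max R (((k : ℝ) + 1) * ε) / (((l : ℝ) + 1) * ε))) := fun k l => by
    have : 0 < max R (((k : ℝ) + 1) * ε) := lt_max_of_lt_left hR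
    have : 0 ≤ min 1 (max R (((k : ℝ) + 1) * ε) / (((l : ℝ) + 1) * ε)) :=
      le_min zero_le_one (by positivity)
    positivity
  rw [ENNReal.ofReal_sum_of_nonneg fun k hk => Finset.sum_nonneg fun l hl =>
    mul_nonneg (mul_nonneg (hm' k hk) (hm' l hl)) (hF k l)]
  refine Finset.sum_congr rfl fun k hk => ?_
  rw [ENNReal.ofReal_sum_of_nonneg fun l hl =>
    mul_nonneg (mul_nonneg (hm' k hk) (hm' l hl)) (hF k l), Finset.mul_sum]
  refine Finset.sum_congr rfl fun l hl => ?_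
  rw [mul_assoc, ENNReal.ofReal_mul (hm' k hk), ENNReal.ofReal_mul (hm' l hl)]

lemma grid_mass_lower_bound (hγ : 0 ≤ γ) (hγρ : γ < ρ) (hρ : ρ < 1) (hC : 0 < C)
    (hK : KernelHyp K γ C) (hε : 0 < ε) {c : ℝ} (hc : 0 ≤ c)
    (hm : ∀ j ≤ n, 0 ≤ m j) (h : MassBound ρ (gridMeasure ε n m))
    (htot : ∑ k ∈ Finset.range (n + 1), m k = (((n : ℝ) + 1) * ε) ^ (1 - ρ))
    (hrec : ∀ J < n, (∑ k ∈ Finset.range (J + 2), m k) / ((((J + 1 : ℕ) : ℝ) + 1) * ε) ^ (1 - ρ) -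
        (∑ k ∈ Finset.range (J + 1), m k) / (((J : ℝ) + 1) * ε) ^ (1 - ρ) =
      c * (1 / (((J : ℝ) + 1) * ε) ^ (1 - ρ) - 1 / ((((J + 1 : ℕ) : ℝ) + 1) * ε) ^ (1 - ρ)) *
        discreteFlux n (fun k l => K (((k : ℝ) + 1) * ε) (((l : ℝ) + 1) * ε) /
          (((l : ℝ) + 1) * ε)) m J)
    {J : ℕ} (hJ : J ≤ n) :
    (((J : ℝ) + 1) * ε) ^ (1 - ρ) *
        (1 - c * C * momentConst γ ρ ^ 2 * (((J : ℝ) + 1) * ε) ^ (γ - ρ)) ≤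
      ∑ k ∈ Finset.range (J + 1), m k := by
  set x : ℕ → ℝ := fun j => ((j : ℝ) + 1) * ε with hx
  have hxp : ∀ j, 0 < x j := fun j => by positivity
  have hxm : Monotone x := fun i j hij => by
    have : (i : ℝ) ≤ j := by exact_mod_cast hij
    simp only [hx]; gcongr
  set e : ℕ → ℝ := fun j => 1 / x j ^ (1 - ρ) with he
  have hea : Antitone e := fun i j hij => by
    have := rpow_le_rpow (hxp i).le (hxm hij) (by linarith : 0 ≤ 1 - ρ)
    have := rpow_pos_of_pos (hxp i) (1 - ρ)
    simp only [he]; gcongr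
  have he' : ∀ j, e j = x j ^ (ρ - 1) := fun j => by
    simp only [he]
    rw [one_div, ← rpow_neg (hxp j).le, neg_sub]
  set w : ℕ → ℕ → ℝ := fun k l => K (x k) (x l) / x l with hw
  set g : ℕ → ℝ := fun i => if J ≤ i then e i - e (i + 1) else 0 with hg
  have hrec' : ∀ i < n, (∑ k ∈ Finset.range (i + 2), m k) / x (i + 1) ^ (1 - ρ) -
        (∑ k ∈ Finset.range (i + 1), m k) / x i ^ (1 - ρ) =
      c * (e i - e (i + 1)) * discreteFlux n w m i := fun i hi => hrec i hi
  have hsum : 1 - (∑ k ∈ Finset.range (J + 1), m k) / x J ^ (1 - ρ) =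
      c * ∑ i ∈ Finset.range n, g i * discreteFlux n w m i := by
    have h1 := sum_Ico_sub_succ
      (fun i => -((∑ k ∈ Finset.range (i + 1), m k) / x i ^ (1 - ρ))) hJ
    have h2 : (∑ k ∈ Finset.range (n + 1), m k) / x n ^ (1 - ρ) = 1 := by
      rw [htot]; exact div_self (rpow_pos_of_pos (hxp n) _).ne'
    rw [h2] at h1
    rw [show 1 - (∑ k ∈ Finset.range (J + 1), m k) / x J ^ (1 - ρ) =
      -((∑ k ∈ Finset.range (J + 1), m k) / x J ^ (1 - ρ)) - -1 by ring, ← h1, Finset.mul_sum]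
    have h3 : Finset.Ico J n = (Finset.range n).filter (fun i => J ≤ i) := by
      ext i; simp; omega
    rw [h3, Finset.sum_filter]
    refine Finset.sum_congr rfl fun i hi => ?_
    simp only [hg]
    split_ifs with hJi
    · rw [← mul_assoc, ← hrec' i (Finset.mem_range.1 hi)]; ring
    · simp
  have hbound : ∑ i ∈ Finset.range n, g i * discreteFlux n w m i ≤
      C * (momentConst γ ρ ^ 2 * x J ^ (γ - ρ)) := by
    rw [sum_mul_discreteFlux]
    refine le_trans ?_ (mul_le_mul_of_nonneg_left
      (gridMeasure_double_sum_le hm h hγ hγρ hρ hε (hxp J)) hC.le)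
    rw [Finset.mul_sum]
    refine Finset.sum_le_sum fun k hk => ?_
    rw [Finset.mul_sum]
    refine Finset.sum_le_sum fun l hl => ?_
    have hmk := hm k (Nat.lt_succ_iff.1 (Finset.mem_range.1 hk))
    have hml := hm l (Nat.lt_succ_iff.1 (Finset.mem_range.1 hl))
    rw [mul_left_comm C]
    refine mul_le_mul_of_nonneg_left ?_ (mul_nonneg hmk hml)
    change w k l * _ ≤ C * (max (x J) (x k) ^ (ρ - 2) * ((x k ^ γ + x l ^ γ) *
      min 1 (max (x J) (x k) / x l)))
    have hmin : 0 ≤ min 1 (max (x J) (x k) / x l) :=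
      le_min zero_le_one (div_nonneg (le_max_of_le_left (hxp J).le) (hxp l).le)
    have hs : 0 < max (x J) (x k) := lt_max_of_lt_left (hxp J)
    have hw0 : 0 ≤ w k l := div_nonneg (hK.nonneg _ _ (hxp k) (hxp l)) (hxp l).le
    have hR0 : 0 ≤ C * (max (x J) (x k) ^ (ρ - 2) * ((x k ^ γ + x l ^ γ) *
        min 1 (max (x J) (x k) / x l))) := by
      have := rpow_pos_of_pos (hxp k) γ
      have := rpow_pos_of_pos (hxp l) γ
      positivity
    have hT : ∑ i ∈ Finset.range n, (if k ≤ i ∧ i ≤ k + l then g i else 0) ≤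
        ∑ i ∈ Finset.Ico (max J k) (k + l + 1), (e i - e (i + 1)) := by
      rw [← Finset.sum_filter]
      have : ∀ i ∈ (Finset.range n).filter (fun i => k ≤ i ∧ i ≤ k + l), g i =
          if J ≤ i then e i - e (i + 1) else 0 := fun i _ => rfl
      rw [Finset.sum_congr rfl this, ← Finset.sum_filter]
      refine Finset.sum_le_sum_of_subset_of_nonneg (fun i hi => ?_)
        fun i _ _ => sub_nonneg.2 (hea i.le_succ)
      simp only [Finset.mem_filter, Finset.mem_range] at hi
      simp only [Finset.mem_Ico, max_le_iff]
      omega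
    refine (mul_le_mul_of_nonneg_left hT hw0).trans ?_
    rcases le_or_gt (max J k) (k + l + 1) with hle | hlt
    · rw [sum_Ico_sub_succ e hle, he', he', hxm.map_max]
      have hadd : x (k + l + 1) = x k + x l := by simp only [hx]; push_cast; ring
      rw [hadd]
      have := rpow_sub_rpow_div_le (hγ.trans_lt hγρ) hρ (hxp k) (hxp l) (le_max_right (x J) (x k))
      calc w k l * (max (x J) (x k) ^ (ρ - 1) - (x k + x l) ^ (ρ - 1))
          = K (x k) (x l) * ((max (x J) (x k) ^ (ρ - 1) - (x k + x l) ^ (ρ - 1)) / x l) := by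
            simp only [hw]; ring
        _ ≤ K (x k) (x l) * (max (x J) (x k) ^ (ρ - 2) * min 1 (max (x J) (x k) / x l)) :=
            mul_le_mul_of_nonneg_left this (hK.nonneg _ _ (hxp k) (hxp l))
        _ ≤ (C * (x k ^ γ + x l ^ γ)) *
              (max (x J) (x k) ^ (ρ - 2) * min 1 (max (x J) (x k) / x l)) :=
            mul_le_mul_of_nonneg_right (hK.growth _ _ (hxp k) (hxp l)) (by positivity)
        _ = _ := by ring
    · rwa [Finset.Ico_eq_empty (by omega), Finset.sum_empty, mul_zero]
  have hPJ := rpow_pos_of_pos (hxp J) (1 - ρ)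
  have h5 := mul_le_mul_of_nonneg_left hbound hc
  rw [← hsum, sub_le_comm, le_div_iff₀ hPJ] at h5
  change x J ^ (1 - ρ) * (1 - c * C * momentConst γ ρ ^ 2 * x J ^ (γ - ρ)) ≤ _
  refine le_trans (le_of_eq ?_) h5
  ring

lemma rpow_slope_bounds {q x y : ℝ} (hq0 : 0 < q) (hq1 : q < 1) (hx : 0 < x) (hxy : x < y) :
    x * (y ^ q - x ^ q) ≤ q * x ^ q * (y - x) ∧ q * x ^ q * (y - x) ≤ y * (y ^ q - x ^ q) := by
  obtain ⟨ξ, hξ, he⟩ := exists_hasDerivAt_eq_slope (fun t : ℝ => t ^ q)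
    (fun t => q * t ^ (q - 1)) hxy
    (continuousOn_id.rpow_const fun t _ => Or.inr hq0.le)
    (fun t ht => hasDerivAt_rpow_const (Or.inl (hx.trans ht.1).ne'))
  have hξ0 : 0 < ξ := hx.trans hξ.1
  have hd : 0 < y - x := sub_pos.2 hxy
  have hs : y ^ q - x ^ q = q * ξ ^ (q - 1) * (y - x) := by
    rw [eq_div_iff hd.ne'] at he; exact he.symm
  rw [hs]
  constructor
  · have h1 : ξ ^ (q - 1) ≤ x ^ (q - 1) := rpow_le_rpow_of_nonpos hx hξ.1.le (by linarith)
    calc x * (q * ξ ^ (q - 1) * (y - x)) ≤ x * (q * x ^ (q - 1) * (y - x)) := by gcongr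
      _ = _ := by rw [rpow_sub_one hx.ne']; field_simp
  · have h1 : x ^ q ≤ ξ ^ q := rpow_le_rpow hx.le hξ.1.le hq0.le
    calc q * x ^ q * (y - x) ≤ q * ξ ^ q * (y - x) := by gcongr
      _ = ξ * (q * ξ ^ (q - 1) * (y - x)) := by rw [rpow_sub_one hξ0.ne']; field_simp
      _ ≤ _ := by
        have : 0 ≤ q * ξ ^ (q - 1) * (y - x) := by positivity
        exact mul_le_mul_of_nonneg_right hξ.2.le this

lemma grid_weak_error (hγρ : γ < ρ) (hρ : ρ < 1) (hγ : 0 ≤ γ) (hε : 0 < ε)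
    (hm : ∀ j ≤ n, 0 ≤ m j) (h : MassBound ρ (gridMeasure ε n m))
    (hrec : ∀ J < n, (∑ k ∈ Finset.range (J + 2), m k) / ((((J + 1 : ℕ) : ℝ) + 1) * ε) ^ (1 - ρ) -
        (∑ k ∈ Finset.range (J + 1), m k) / (((J : ℝ) + 1) * ε) ^ (1 - ρ) =
      (ρ - γ) / (1 - ρ) *
        (1 / (((J : ℝ) + 1) * ε) ^ (1 - ρ) - 1 / ((((J + 1 : ℕ) : ℝ) + 1) * ε) ^ (1 - ρ)) *
        discreteFlux n (fun k l => K (((k : ℝ) + 1) * ε) (((l : ℝ) + 1) * ε) /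
          (((l : ℝ) + 1) * ε)) m J)
    {ψ ψ' : ℝ → ℝ} (hψ : ∀ x, HasDerivAt ψ (ψ' x) x) {X L η : ℝ} (hX : 0 < X) (hXn : X ≤ n * ε)
    (hψX : ∀ x, X ≤ x → ψ x = 0) (hψX' : ∀ x, X ≤ x → ψ' x = 0) (hL : ∀ x, |ψ' x| ≤ L)
    (hη : ∀ x y, |x - y| ≤ ε → |ψ' x - ψ' y| ≤ η) :
    |∫ x, x * ψ' x + (1 - ρ) * ψ x ∂gridMeasure ε n m - (ρ - γ) *
        ∫ y, ∫ z, K y z / z * (ψ (y + z) - ψ y) ∂gridMeasure ε n m ∂gridMeasure ε n m| ≤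
      ((X + ε) * η + L * ε) * (X + ε) ^ (1 - ρ) := by
  set x : ℕ → ℝ := fun j => ((j : ℝ) + 1) * ε with hx
  have hxp : ∀ j, 0 < x j := fun j => by positivity
  have hxs : ∀ j, x (j + 1) = x j + ε := fun j => by simp only [hx]; push_cast; ring
  have hρ' : (0 : ℝ) < 1 - ρ := by linarith
  set P : ℕ → ℝ := fun j => x j ^ (1 - ρ) with hP
  have hPp : ∀ j, 0 < P j := fun j => rpow_pos_of_pos (hxp j) _
  have hPlt : ∀ j, P j < P (j + 1) := fun j =>
    rpow_lt_rpow (hxp j).le (by rw [hxs]; linarith) hρ'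
  set w : ℕ → ℕ → ℝ := fun k l => K (x k) (x l) / x l with hw
  set D : ℕ → ℝ := fun j => ψ (x (j + 1)) - ψ (x j) with hD
  set a : ℕ → ℝ := fun j => (1 - ρ) * P j / (P (j + 1) - P j) with ha
  have hn : 0 < n := by
    rcases Nat.eq_zero_or_pos n with h0 | h0
    · simp [h0] at hXn; linarith
    · exact h0
  have hL0 : 0 ≤ L := (abs_nonneg _).trans (hL 0)
  have hη0 : 0 ≤ η := (abs_nonneg _).trans (hη 0 0 (by simpa using hε.le))
  have hrel : ∀ J < n, a J * m (J + 1) = (1 - ρ) * ∑ k ∈ Finset.range (J + 1), m k +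
      (ρ - γ) * discreteFlux n w m J := by
    intro J hJ
    have h1 : (∑ k ∈ Finset.range (J + 2), m k) / P (J + 1) -
        (∑ k ∈ Finset.range (J + 1), m k) / P J =
      (ρ - γ) / (1 - ρ) * (1 / P J - 1 / P (J + 1)) * discreteFlux n w m J := hrec J hJ
    rw [Finset.sum_range_succ] at h1
    have h2 := (hPp J).ne'
    have h3 := (hPp (J + 1)).ne'
    have h4 := (sub_pos.2 (hPlt J)).ne'
    have h5 := hρ'.ne'
    field_simp at h1
    simp only [ha]
    field_simp
    linear_combination h1
  have hvan : ∀ j, n - 1 ≤ j → ψ (x j) = 0 := fun j hj => hψX _ (by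
    refine hXn.trans ?_
    have : (n : ℝ) ≤ j + 1 := by exact_mod_cast (by omega : n ≤ j + 1)
    simp only [hx]; gcongr)
  have hparts : ∑ J ∈ Finset.range n, D J * ∑ k ∈ Finset.range (J + 1), m k =
      -∑ k ∈ Finset.range (n + 1), m k * ψ (x k) := by
    have := sum_range_sub_mul_sum (fun j => ψ (x j)) m n
    simp only [hvan n (by omega), zero_sub, mul_neg, Finset.sum_neg_distrib] at this
    exact this
  have hflux : ∑ J ∈ Finset.range n, D J * discreteFlux n w m J =
      ∑ k ∈ Finset.range (n + 1), ∑ l ∈ Finset.range (n + 1), m k * m l *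
        (w k l * (ψ (x k + x l) - ψ (x k))) := by
    rw [sum_mul_discreteFlux]
    refine Finset.sum_congr rfl fun k _ => Finset.sum_congr rfl fun l _ => ?_
    congr 2
    rw [← Finset.sum_filter]
    have hadd : x k + x l = x (k + l + 1) := by simp only [hx]; push_cast; ring
    rw [hadd, ← Finset.sum_Ico_sub (fun j => ψ (x j)) (by omega : k ≤ k + l + 1)]
    refine Finset.sum_subset (fun i hi => ?_) (fun i hi hi' => ?_)
    · simp only [Finset.mem_filter, Finset.mem_range] at hi
      simp only [Finset.mem_Ico]; omega
    · simp only [Finset.mem_Ico] at hi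
      simp only [Finset.mem_filter, Finset.mem_range] at hi'
      change ψ (x (i + 1)) - ψ (x i) = 0
      rw [hvan i (by omega), hvan (i + 1) (by omega), sub_zero]
  have hexact : ∑ J ∈ Finset.range n, m (J + 1) * (a J * D J) =
      -((1 - ρ) * ∑ k ∈ Finset.range (n + 1), m k * ψ (x k)) +
      (ρ - γ) * ∑ k ∈ Finset.range (n + 1), ∑ l ∈ Finset.range (n + 1), m k * m l *
        (w k l * (ψ (x k + x l) - ψ (x k))) := by
    rw [← hflux, ← mul_neg, ← hparts, Finset.mul_sum, Finset.mul_sum, ← Finset.sum_add_distrib]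
    refine Finset.sum_congr rfl fun J hJ => ?_
    linear_combination D J * hrel J (Finset.mem_range.1 hJ)
  have hI : ∫ y, ∫ z, K y z / z * (ψ (y + z) - ψ y) ∂gridMeasure ε n m ∂gridMeasure ε n m =
      ∑ k ∈ Finset.range (n + 1), ∑ l ∈ Finset.range (n + 1), m k * m l *
        (w k l * (ψ (x k + x l) - ψ (x k))) := by
    rw [integral_gridMeasure hm]
    refine Finset.sum_congr rfl fun k _ => ?_
    rw [integral_gridMeasure hm, Finset.mul_sum]
    exact Finset.sum_congr rfl fun l _ => by simp only [hw]; ring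
  have hI' : ∫ x, x * ψ' x + (1 - ρ) * ψ x ∂gridMeasure ε n m =
      ∑ J ∈ Finset.range n, m (J + 1) * (x (J + 1) * ψ' (x (J + 1))) + m 0 * (x 0 * ψ' (x 0)) +
      (1 - ρ) * ∑ k ∈ Finset.range (n + 1), m k * ψ (x k) := by
    rw [← Finset.sum_range_succ' (fun J => m J * (x J * ψ' (x J))), integral_gridMeasure hm,
      Finset.mul_sum, ← Finset.sum_add_distrib]
    exact Finset.sum_congr rfl fun l _ => by simp only [hx]; ring
  set E : ℝ := (X + ε) * η + L * ε with hE
  have hE0 : 0 ≤ E := by positivity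
  set χ : ℝ → ℝ := (Icc 0 (X + ε)).indicator 1 with hχ
  have hterm : ∀ J, |x (J + 1) * ψ' (x (J + 1)) - a J * D J| ≤ E * χ (x (J + 1)) := by
    intro J
    rcases le_or_gt X (x J) with hXJ | hXJ
    · have : X ≤ x (J + 1) := by rw [hxs]; linarith
      simp only [hD, hψX _ hXJ, hψX _ this, hψX' _ this, mul_zero, sub_self, abs_zero]
      exact mul_nonneg hE0 (indicator_nonneg (fun _ _ => zero_le_one) _)
    · have hmem : x (J + 1) ∈ Icc 0 (X + ε) := ⟨(hxp _).le, by rw [hxs]; linarith⟩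
      simp only [hχ, indicator_of_mem hmem, Pi.one_apply, mul_one]
      have hlt : x J < x (J + 1) := by rw [hxs]; linarith
      obtain ⟨ξ, hξ, he⟩ := exists_hasDerivAt_eq_slope ψ ψ' hlt
        (fun t _ => (hψ t).continuousAt.continuousWithinAt) (fun t _ => hψ t)
      have hDJ : D J = ψ' ξ * ε := by
        rw [he, hxs, add_sub_cancel_left, div_mul_cancel₀ _ hε.ne', ← hxs]
      obtain ⟨hs1, hs2⟩ := rpow_slope_bounds hρ' (by linarith) (hxp J) hlt
      have hd : 0 < P (J + 1) - P J := sub_pos.2 (hPlt J)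
      have ht : a J * ε = (1 - ρ) * P J * ε / (P (J + 1) - P J) := by simp only [ha]; ring
      have hxe : x (J + 1) - x J = ε := by rw [hxs]; ring
      rw [hxe] at hs1 hs2
      have ht1 : x J ≤ a J * ε := by rw [ht, le_div_iff₀ hd]; exact hs1
      have ht2 : a J * ε ≤ x (J + 1) := by rw [ht, div_le_iff₀ hd]; exact hs2
      calc |x (J + 1) * ψ' (x (J + 1)) - a J * D J|
          = |x (J + 1) * (ψ' (x (J + 1)) - ψ' ξ) + ψ' ξ * (x (J + 1) - a J * ε)| := by
            rw [hDJ]; congr 1; ring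
        _ ≤ |x (J + 1) * (ψ' (x (J + 1)) - ψ' ξ)| + |ψ' ξ * (x (J + 1) - a J * ε)| :=
            abs_add_le _ _
        _ = x (J + 1) * |ψ' (x (J + 1)) - ψ' ξ| + |ψ' ξ| * (x (J + 1) - a J * ε) := by
            rw [abs_mul (x (J + 1)), abs_mul (ψ' ξ), abs_of_pos (hxp _), abs_of_nonneg (sub_nonneg.2 ht2)]
        _ ≤ (X + ε) * η + L * ε := by
            have h1 : |ψ' (x (J + 1)) - ψ' ξ| ≤ η := hη _ _ (by
              rw [abs_of_pos (sub_pos.2 hξ.2)]; linarith [hξ.1])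
            exact add_le_add (mul_le_mul hmem.2 h1 (abs_nonneg _) (by positivity))
              (mul_le_mul (hL _) (by linarith) (by linarith) hL0)
  have hterm0 : |x 0 * ψ' (x 0)| ≤ E * χ (x 0) := by
    have hx0 : x 0 = ε := by simp [hx]
    have hmem : x 0 ∈ Icc 0 (X + ε) := ⟨(hxp _).le, by rw [hx0]; linarith⟩
    simp only [hχ, indicator_of_mem hmem, Pi.one_apply, mul_one]
    rw [abs_mul, abs_of_pos (hxp 0), hx0, hE]
    have := mul_le_mul_of_nonneg_left (hL ε) hε.le
    have : 0 ≤ (X + ε) * η := by positivity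
    linarith
  have hm' : ∀ j ∈ Finset.range (n + 1), 0 ≤ m j := fun j hj =>
    hm j (Nat.lt_succ_iff.1 (Finset.mem_range.1 hj))
  calc _ = |∑ J ∈ Finset.range n, m (J + 1) * (x (J + 1) * ψ' (x (J + 1)) - a J * D J) +
          m 0 * (x 0 * ψ' (x 0))| := by
        rw [hI, hI']
        congr 1
        rw [Finset.sum_congr rfl fun J _ => mul_sub (m (J + 1)) (x (J + 1) * ψ' (x (J + 1)))
          (a J * D J), Finset.sum_sub_distrib]
        linear_combination hexact
    _ ≤ ∑ J ∈ Finset.range n, m (J + 1) * (E * χ (x (J + 1))) + m 0 * (E * χ (x 0)) := by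
        refine (abs_add_le _ _).trans (add_le_add ((Finset.abs_sum_le_sum_abs _ _).trans
          (Finset.sum_le_sum fun J hJ => ?_)) ?_)
        · have h0 : 0 ≤ m (J + 1) := hm _ (Finset.mem_range.1 hJ)
          rw [abs_mul, abs_of_nonneg h0]
          exact mul_le_mul_of_nonneg_left (hterm J) h0
        · rw [abs_mul, abs_of_nonneg (hm 0 n.zero_le)]
          exact mul_le_mul_of_nonneg_left hterm0 (hm 0 n.zero_le)
    _ = E * ∫ x, χ x ∂gridMeasure ε n m := by
        rw [← Finset.sum_range_succ' (fun J => m J * (E * χ (x J))), integral_gridMeasure hm,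
          Finset.mul_sum]
        exact Finset.sum_congr rfl fun l _ => by simp only [hx]; ring
    _ = E * (gridMeasure ε n m).real (Icc 0 (X + ε)) := by
        rw [hχ, integral_indicator_one measurableSet_Icc]
    _ ≤ E * (X + ε) ^ (1 - ρ) := by
        gcongr
        exact ENNReal.toReal_le_of_le_ofReal (by positivity) (h.le _ (by positivity))

end Approximants

section ApproximatingSequence

variable {γ C ρ : ℝ} {K : ℝ → ℝ → ℝ}

lemma exists_approximating_sequence (hγ : 0 ≤ γ) (hγρ : γ < ρ) (hρ : ρ < 1) (hC : 0 < C)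
    (hK : KernelHyp K γ C) :
    ∃ B > (0 : ℝ), ∃ μ : ℕ → Measure ℝ, (∀ N, MassBound ρ (μ N)) ∧
      (∀ R R' : ℝ, 0 < R → R < R' → ∀ᶠ N in atTop,
        ENNReal.ofReal (R ^ (1 - ρ) * (1 - B * R ^ (γ - ρ))) ≤ μ N (Icc 0 R')) ∧
      ∀ ψ : ℝ → ℝ, ContDiff ℝ 1 ψ → HasCompactSupport ψ →
        Tendsto (fun N => ∫ x, x * deriv ψ x + (1 - ρ) * ψ x ∂μ N - (ρ - γ) *
          ∫ y, ∫ z, K y z / z * (ψ (y + z) - ψ y) ∂μ N ∂μ N) atTop (𝓝 0) := by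
  set c := (ρ - γ) / (1 - ρ) with hc
  have hc0 : 0 < c := div_pos (by linarith) (by linarith)
  have hA := one_le_momentConst hγ hγρ hρ
  set ε : ℕ → ℝ := fun N => 1 / ((N : ℝ) + 1) with hε
  have hεp : ∀ N, 0 < ε N := fun N => by positivity
  have hε0 : Tendsto ε atTop (𝓝 0) := tendsto_one_div_add_atTop_nhds_zero_nat
  have hnε : ∀ N : ℕ, (((N + 1) ^ 2 : ℕ) : ℝ) * ε N = N + 1 := fun N => by
    simp only [hε]; push_cast; field_simp
  have hsol := fun N : ℕ => exists_discrete_solution ((N + 1) ^ 2)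
    (fun j => (((j : ℝ) + 1) * ε N) ^ (1 - ρ)) (fun j => by have := hεp N; positivity)
    (fun i j hij => by
      have : (i : ℝ) ≤ j := by exact_mod_cast hij
      have := hεp N
      exact rpow_le_rpow (by positivity) (by gcongr) (by linarith))
    (fun k l => K (((k : ℝ) + 1) * ε N) (((l : ℝ) + 1) * ε N) / (((l : ℝ) + 1) * ε N))
    (fun k l => by
      have := hεp N
      exact div_nonneg (hK.nonneg _ _ (by positivity) (by positivity)) (by positivity)) c hc0.le
  choose m hm htot hM hrec using hsol
  have hb : ∀ N, MassBound ρ (gridMeasure (ε N) ((N + 1) ^ 2) (m N)) := fun N =>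
    massBound_gridMeasure hρ (hεp N) (hm N) (hM N)
  refine ⟨c * C * momentConst γ ρ ^ 2, by positivity,
    fun N => gridMeasure (ε N) ((N + 1) ^ 2) (m N), hb,
    fun R R' hR hRR' => ?_, fun ψ hψ hψc => ?_⟩
  · set B := c * C * momentConst γ ρ ^ 2 with hB
    have hB0 : 0 < B := by positivity
    rcases le_or_gt (1 - B * R ^ (γ - ρ)) 0 with hneg | hpos
    · refine Eventually.of_forall fun N => ?_
      rw [ENNReal.ofReal_of_nonpos (mul_nonpos_of_nonneg_of_nonpos (by positivity) hneg)]
      exact zero_le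
    have h1 : ∀ᶠ N in atTop, R + 2 * ε N < R' := by
      have : Tendsto (fun N => R + 2 * ε N) atTop (𝓝 (R + 2 * 0)) :=
        tendsto_const_nhds.add (hε0.const_mul 2)
      exact this.eventually_lt_const (by linarith)
    filter_upwards [h1, eventually_ge_atTop ⌈R⌉₊] with N hN hN'
    set J := ⌈R / ε N⌉₊ with hJ
    have hJ1 : R ≤ ((J : ℝ) + 1) * ε N := by
      rw [← div_le_iff₀ (hεp N)]
      exact (Nat.le_ceil _).trans (by linarith)
    have hJ2 : ((J : ℝ) + 1) * ε N ≤ R' := by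
      have : (J : ℝ) < R / ε N + 1 := Nat.ceil_lt_add_one (div_nonneg hR.le (hεp N).le)
      calc ((J : ℝ) + 1) * ε N ≤ (R / ε N + 1 + 1) * ε N := by
            have := hεp N; gcongr
        _ = R + 2 * ε N := by have := (hεp N).ne'; field_simp; ring
        _ ≤ R' := hN.le
    have hJn : J ≤ (N + 1) ^ 2 := by
      refine Nat.ceil_le.2 ?_
      rw [div_le_iff₀ (hεp N), hnε]
      have : R ≤ N := Nat.ceil_le.1 hN'
      linarith
    refine le_trans (ENNReal.ofReal_le_ofReal ?_)
      (gridMeasure_Icc_ge (hεp N) (hm N) hJn hJ2)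
    refine le_trans ?_ (grid_mass_lower_bound hγ hγρ hρ hC hK (hεp N) hc0.le (hm N) (hb N)
      (htot N) (hrec N) hJn)
    have h2 : (((J : ℝ) + 1) * ε N) ^ (γ - ρ) ≤ R ^ (γ - ρ) :=
      rpow_le_rpow_of_nonpos hR hJ1 (by linarith)
    have h3 : R ^ (1 - ρ) ≤ (((J : ℝ) + 1) * ε N) ^ (1 - ρ) :=
      rpow_le_rpow hR.le hJ1 (by linarith)
    gcongr
  · have hd := hψ.continuous_deriv le_rfl
    have hdc := hψc.deriv
    obtain ⟨L, hL⟩ := hd.bounded_above_of_compact_support hdc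
    have huc := hdc.uniformContinuous_of_continuous hd
    obtain ⟨X₀, hX₀⟩ := hψc.isCompact.bddAbove
    set X := max 0 X₀ + 1 with hX
    have hX1 : 1 ≤ X := by simp [hX]
    have hnot : ∀ x, X ≤ x → x ∉ tsupport ψ := fun x hx hx' => by
      have := hX₀ hx'
      have := le_max_right 0 X₀
      linarith
    have hψX : ∀ x, X ≤ x → ψ x = 0 := fun x hx => image_eq_zero_of_notMem_tsupport (hnot x hx)
    have hψX' : ∀ x, X ≤ x → deriv ψ x = 0 := fun x hx => by
      by_contra h0
      exact hnot x hx (support_deriv_subset h0)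
    have hL0 : 0 ≤ L := (norm_nonneg _).trans (hL 0)
    rw [Metric.tendsto_atTop']
    intro e he
    set Q := (X + 1) ^ (1 - ρ) with hQ
    have hQ0 : 0 < Q := by positivity
    obtain ⟨d, hd0, hd⟩ := Metric.uniformContinuous_iff.1 huc (e / (2 * ((X + 1) * Q)))
      (by positivity)
    have h1 : ∀ᶠ N in atTop, ε N < d := hε0.eventually_lt_const hd0
    have h2 : ∀ᶠ N in atTop, L * ε N * Q < e / 2 := by
      have : Tendsto (fun N => L * ε N * Q) atTop (𝓝 (L * 0 * Q)) :=
        (hε0.const_mul L).mul_const Q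
      exact this.eventually_lt_const (by simpa using he)
    obtain ⟨N₀, hN₀⟩ := eventually_atTop.1 (h1.and (h2.and (eventually_ge_atTop ⌈X⌉₊)))
    refine ⟨N₀, fun N hN => ?_⟩
    obtain ⟨hN1, hN2, hN3⟩ := hN₀ N hN.le
    have hε1 : ε N ≤ 1 := by
      simp only [hε]
      rw [div_le_one (by positivity)]
      have : (0 : ℝ) ≤ N := N.cast_nonneg
      linarith
    have herr := grid_weak_error (K := K) hγρ hρ hγ (hεp N) (hm N) (hb N) (hrec N)
      (ψ := ψ) (ψ' := deriv ψ) (X := X) (L := L) (η := e / (2 * ((X + 1) * Q)))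
      (fun x => (hψ.differentiable one_ne_zero x).hasDerivAt) (by linarith)
      (by
        rw [hnε]
        have : X ≤ N := Nat.ceil_le.1 hN3
        linarith)
      hψX hψX' (fun x => hL x) (fun x y hxy => (hd (hxy.trans_lt hN1)).le)
    rw [dist_zero_right, norm_eq_abs]
    refine herr.trans_lt ?_
    have hεN := hεp N
    calc ((X + ε N) * (e / (2 * ((X + 1) * Q))) + L * ε N) * (X + ε N) ^ (1 - ρ)
        ≤ ((X + 1) * (e / (2 * ((X + 1) * Q))) + L * ε N) * Q := by
          have h : (X + ε N) ^ (1 - ρ) ≤ Q :=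
            rpow_le_rpow (by positivity) (by linarith) (by linarith)
          gcongr
      _ = e / 2 + L * ε N * Q := by field_simp
      _ < e := by linarith

end ApproximatingSequence

section VagueLimit

/-- The piecewise affine function equal to `1` on `[a, b]` and to `0` outside
`(a - d, b + d)`. -/
def plateau (a b d x : ℝ) : ℝ := max 0 (min 1 (1 + min (x - a) (b - x) / d))

variable {a b d x : ℝ}

lemma plateau_nonneg : 0 ≤ plateau a b d x := le_max_left _ _

lemma plateau_le_one : plateau a b d x ≤ 1 := max_le zero_le_one (min_le_left _ _)

lemma continuous_plateau : Continuous (plateau a b d) := by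
  unfold plateau; fun_prop

lemma plateau_eq_one (hd : 0 < d) (hx : x ∈ Icc a b) : plateau a b d x = 1 := by
  have : 0 ≤ min (x - a) (b - x) / d :=
    div_nonneg (le_min (sub_nonneg.2 hx.1) (sub_nonneg.2 hx.2)) hd.le
  unfold plateau
  rw [min_eq_left (by linarith), max_eq_right zero_le_one]

lemma plateau_eq_zero (hd : 0 < d) (hx : x ∉ Icc (a - d) (b + d)) : plateau a b d x = 0 := by
  have : min (x - a) (b - x) / d ≤ -1 := by
    rw [div_le_iff₀ hd, min_le_iff]
    by_contra! h
    exact hx ⟨by linarith [h.1], by linarith [h.2]⟩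
  unfold plateau
  rw [max_eq_left ((min_le_right _ _).trans (by linarith))]

lemma hasCompactSupport_plateau (hd : 0 < d) : HasCompactSupport (plateau a b d) :=
  HasCompactSupport.intro isCompact_Icc fun _ hx => plateau_eq_zero hd hx

lemma measure_Icc_le_integral_plateau (μ : Measure ℝ) [IsFiniteMeasureOnCompacts μ] (hd : 0 < d) :
    μ (Icc a b) ≤ ENNReal.ofReal (∫ x, plateau a b d x ∂μ) := by
  rw [ofReal_integral_eq_lintegral_ofReal (continuous_plateau.integrable_of_hasCompactSupport
    (hasCompactSupport_plateau hd)) (Eventually.of_forall fun x => plateau_nonneg),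
    ← lintegral_indicator_one measurableSet_Icc]
  refine lintegral_mono fun x => ?_
  by_cases hx : x ∈ Icc a b
  · simp [plateau_eq_one hd hx, indicator_of_mem hx]
  · simp [hx]

lemma integral_plateau_le_measure_Icc (μ : Measure ℝ) [IsFiniteMeasureOnCompacts μ] (hd : 0 < d) :
    ENNReal.ofReal (∫ x, plateau a b d x ∂μ) ≤ μ (Icc (a - d) (b + d)) := by
  rw [ofReal_integral_eq_lintegral_ofReal (continuous_plateau.integrable_of_hasCompactSupport
    (hasCompactSupport_plateau hd)) (Eventually.of_forall fun x => plateau_nonneg),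
    ← lintegral_indicator_one measurableSet_Icc]
  refine lintegral_mono fun x => ?_
  by_cases hx : x ∈ Icc (a - d) (b + d)
  · simpa [hx] using plateau_le_one
  · simp [plateau_eq_zero hd hx]

variable {ρ : ℝ}

lemma MassBound.measure_le {μ : Measure ℝ} (h : MassBound ρ μ) {R : ℝ} (hR : 0 < R) {s : Set ℝ}
    (hs : s ⊆ Iic R) : μ s ≤ ENNReal.ofReal (R ^ (1 - ρ)) := by
  have hsub : s ⊆ Iic 0 ∪ Icc 0 R := fun x hx => by
    rcases le_total x 0 with h0 | h0
    · exact Or.inl h0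
    · exact Or.inr ⟨h0, hs hx⟩
  refine (measure_mono hsub).trans ((measure_union_le _ _).trans ?_)
  rw [h.null, zero_add]
  exact h.le R hR

lemma MassBound.isFiniteMeasureOnCompacts {μ : Measure ℝ} (h : MassBound ρ μ) :
    IsFiniteMeasureOnCompacts μ := by
  refine ⟨fun s hs => ?_⟩
  obtain ⟨X, hX⟩ := hs.bddAbove
  exact (h.measure_le (R := max 1 X) (by positivity)
    fun x hx => (hX hx).trans (le_max_right _ _)).trans_lt ENNReal.ofReal_lt_top

lemma MassBound.norm_integral_le {μ : Measure ℝ} (h : MassBound ρ μ) {f : ℝ → ℝ} {R L : ℝ}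
    (hR : 0 < R) (hfR : ∀ x, R < x → f x = 0) (hL : ∀ x, |f x| ≤ L) :
    |∫ x, f x ∂μ| ≤ L * R ^ (1 - ρ) := by
  have hL0 : 0 ≤ L := (abs_nonneg _).trans (hL 0)
  have hlt : μ (Iic R) < ⊤ := (h.measure_le hR subset_rfl).trans_lt ENNReal.ofReal_lt_top
  rw [← setIntegral_eq_integral_of_forall_compl_eq_zero (s := Iic R)
    (fun x hx => hfR x (not_le.1 hx)), ← norm_eq_abs]
  refine (norm_setIntegral_le_of_norm_le_const hlt fun x _ => hL x).trans ?_
  gcongr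
  exact ENNReal.toReal_le_of_le_ofReal (by positivity) (h.measure_le hR subset_rfl)

lemma exists_vague_limit (hρ : ρ < 1) (μ : ℕ → Measure ℝ) (hμ : ∀ N, MassBound ρ (μ N))
    (𝓕 : Ultrafilter ℕ) :
    ∃ ν : Measure ℝ, MassBound ρ ν ∧ ∀ f : ℝ → ℝ, Continuous f → HasCompactSupport f →
      Tendsto (fun N => ∫ x, f x ∂μ N) 𝓕 (𝓝 (∫ x, f x ∂ν)) := by
  have hfin : ∀ N, IsFiniteMeasureOnCompacts (μ N) := fun N => (hμ N).isFiniteMeasureOnCompacts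
  have hint : ∀ N (f : CompactlySupportedContinuousMap ℝ ℝ), Integrable f (μ N) := fun N f =>
    f.continuous.integrable_of_hasCompactSupport f.hasCompactSupport
  have hlim : ∀ f : CompactlySupportedContinuousMap ℝ ℝ, ∃ l,
      Tendsto (fun N => ∫ x, f x ∂μ N) 𝓕 (𝓝 l) := by
    intro f
    obtain ⟨L, hL⟩ := f.continuous.bounded_above_of_compact_support f.hasCompactSupport
    obtain ⟨X, hX⟩ := f.hasCompactSupport.isCompact.bddAbove
    set R := max 1 X with hR
    have hR0 : 0 < R := by positivity
    have hmem : ∀ N, ∫ x, f x ∂μ N ∈ Icc (-(L * R ^ (1 - ρ))) (L * R ^ (1 - ρ)) := fun N => by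
      rw [mem_Icc, ← abs_le]
      refine (hμ N).norm_integral_le hR0 (fun x hx => ?_) hL
      refine image_eq_zero_of_notMem_tsupport fun hx' => ?_
      have := hX hx'
      have := le_max_right 1 X
      linarith
    obtain ⟨l, -, hl⟩ := isCompact_Icc.ultrafilter_le_nhds (𝓕.map fun N => ∫ x, f x ∂μ N)
      (le_principal_iff.2 (mem_map.2 (Eventually.of_forall hmem)))
    exact ⟨l, hl⟩
  choose Λ hΛ using hlim
  let Λl : CompactlySupportedContinuousMap ℝ ℝ →ₗ[ℝ] ℝ :=
    { toFun := Λ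
      map_add' := fun f g => by
        refine tendsto_nhds_unique (hΛ (f + g)) (((hΛ f).add (hΛ g)).congr fun N => ?_)
        exact (integral_add (hint N f) (hint N g)).symm
      map_smul' := fun c f => by
        refine tendsto_nhds_unique (hΛ (c • f)) (((hΛ f).const_mul c).congr fun N => ?_)
        exact (integral_const_mul c _).symm }
  let Λp : CompactlySupportedContinuousMap ℝ ℝ →ₚ[ℝ] ℝ := PositiveLinearMap.mk₀ Λl fun f hf =>
    ge_of_tendsto' (hΛ f) fun N => integral_nonneg hf
  set ν := RealRMK.rieszMeasure Λp with hν
  have hlimν : ∀ f : ℝ → ℝ, Continuous f → HasCompactSupport f →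
      Tendsto (fun N => ∫ x, f x ∂μ N) 𝓕 (𝓝 (∫ x, f x ∂ν)) := by
    intro f hf hfc
    have h1 := RealRMK.integral_rieszMeasure Λp ⟨⟨f, hf⟩, hfc⟩
    have h2 := hΛ ⟨⟨f, hf⟩, hfc⟩
    change ∫ x, f x ∂ν = Λ ⟨⟨f, hf⟩, hfc⟩ at h1
    rw [h1]
    exact h2
  have hIcc : ∀ (k R d : ℝ), 0 < d → 0 ≤ R →
      ν (Icc (-k) R) ≤ ENNReal.ofReal ((R + d) ^ (1 - ρ)) := by
    intro k R d hd hR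
    refine (measure_Icc_le_integral_plateau ν hd).trans (ENNReal.ofReal_le_ofReal ?_)
    refine le_of_tendsto' (hlimν _ continuous_plateau (hasCompactSupport_plateau hd)) fun N => ?_
    have := (integral_plateau_le_measure_Icc (a := -k) (b := R) (μ N) hd).trans
      ((hμ N).measure_le (R := R + d) (by positivity) fun x hx => hx.2)
    rwa [ENNReal.ofReal_le_ofReal_iff (by positivity)] at this
  have hIic : ∀ (R d : ℝ), 0 < d → 0 ≤ R → ν (Iic R) ≤ ENNReal.ofReal ((R + d) ^ (1 - ρ)) := by
    intro R d hd hR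
    have hU : Iic R = ⋃ k : ℕ, Icc (-(k : ℝ)) R := by
      ext x
      simp only [mem_Iic, mem_iUnion, mem_Icc]
      refine ⟨fun hx => ?_, fun ⟨_, h⟩ => h.2⟩
      obtain ⟨k, hk⟩ := exists_nat_ge (-x)
      exact ⟨k, by linarith, hx⟩
    have hmono : Monotone fun k : ℕ => Icc (-(k : ℝ)) R := fun i j hij =>
      Icc_subset_Icc_left (neg_le_neg (by exact_mod_cast hij))
    rw [hU, hmono.measure_iUnion]
    exact iSup_le fun k => hIcc k R d hd hR
  have hIic' : ∀ R : ℝ, 0 ≤ R → ν (Iic R) ≤ ENNReal.ofReal (R ^ (1 - ρ)) := by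
    intro R hR
    have hc : Tendsto (fun d : ℝ => ENNReal.ofReal ((R + d) ^ (1 - ρ))) (𝓝[>] 0)
        (𝓝 (ENNReal.ofReal ((R + 0) ^ (1 - ρ)))) := by
      have h1 : Continuous fun d : ℝ => ENNReal.ofReal ((R + d) ^ (1 - ρ)) :=
        ENNReal.continuous_ofReal.comp
          ((continuous_const.add continuous_id).rpow_const fun _ => Or.inr (by linarith))
      exact (h1.tendsto 0).mono_left nhdsWithin_le_nhds
    rw [add_zero] at hc
    exact ge_of_tendsto hc (by
      filter_upwards [self_mem_nhdsWithin] with d hd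
      exact hIic R d hd hR)
  refine ⟨ν, ⟨?_, fun R hR => (measure_mono Icc_subset_Iic_self).trans (hIic' R hR.le)⟩, hlimν⟩
  have := hIic' 0 le_rfl
  rw [zero_rpow (by linarith), ENNReal.ofReal_zero] at this
  exact le_antisymm this zero_le

lemma MassBound.le_of_vague_limit {μ : ℕ → Measure ℝ} (hμ : ∀ N, MassBound ρ (μ N)) {ν : Measure ℝ}
    (hν : MassBound ρ ν) {𝓕 : Filter ℕ} [𝓕.NeBot]
    (hlim : ∀ f : ℝ → ℝ, Continuous f → HasCompactSupport f →
      Tendsto (fun N => ∫ x, f x ∂μ N) 𝓕 (𝓝 (∫ x, f x ∂ν)))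
    {ℓ : ℝ → ℝ} (hℓ : ContinuousOn ℓ (Ioi 0))
    (hlow : ∀ R R' : ℝ, 0 < R → R < R' → ∀ᶠ N in 𝓕, ENNReal.ofReal (ℓ R) ≤ μ N (Icc 0 R'))
    {R : ℝ} (hR : 0 < R) : ENNReal.ofReal (ℓ R) ≤ ν (Icc 0 R) := by
  have hfinν := hν.isFiniteMeasureOnCompacts
  have hr : ∀ r ∈ Ioo 0 R, ENNReal.ofReal (ℓ r) ≤ ν (Icc 0 R) := by
    intro r hr
    obtain ⟨r', hr1, hr2⟩ := exists_between hr.2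
    have hd : 0 < R - r' := sub_pos.2 hr2
    have h1 : ENNReal.ofReal (ℓ r) ≤ ENNReal.ofReal (∫ x, plateau 0 r' (R - r') x ∂ν) := by
      refine ge_of_tendsto ((ENNReal.continuous_ofReal.tendsto _).comp
        (hlim _ continuous_plateau (hasCompactSupport_plateau hd))) ?_
      filter_upwards [hlow r r' hr.1 hr1] with N hN
      have := (hμ N).isFiniteMeasureOnCompacts
      exact hN.trans (measure_Icc_le_integral_plateau (μ N) hd)
    refine h1.trans ((integral_plateau_le_measure_Icc ν hd).trans ?_)
    have hsub : Icc (0 - (R - r')) (r' + (R - r')) ⊆ Iic 0 ∪ Icc 0 R := fun x hx => by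
      rcases le_total x 0 with h0 | h0
      · exact Or.inl h0
      · exact Or.inr ⟨h0, hx.2.trans_eq (by ring)⟩
    refine (measure_mono hsub).trans ((measure_union_le _ _).trans ?_)
    rw [hν.null, zero_add]
  have hc : Tendsto (fun r => ENNReal.ofReal (ℓ r)) (𝓝[<] R) (𝓝 (ENNReal.ofReal (ℓ R))) :=
    (ENNReal.continuous_ofReal.tendsto _).comp
      ((hℓ.continuousAt (Ioi_mem_nhds hR)).tendsto.mono_left nhdsWithin_le_nhds)
  refine le_of_tendsto hc ?_
  filter_upwards [Ioo_mem_nhdsLT hR] with r h using hr r h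

end VagueLimit

section Product

/-- The function dominating the integrands of the double integrals in the weak formulation. -/
def dominant (γ X : ℝ) (p : ℝ × ℝ) : ℝ :=
  (Iic X).indicator 1 p.1 * ((p.1 ^ γ + p.2 ^ γ) * min 1 (X / p.2))

variable {γ ρ X : ℝ} {μ : Measure ℝ}

lemma measurable_dominant : Measurable (dominant γ X) := by
  unfold dominant
  exact ((measurable_one.indicator measurableSet_Iic).comp measurable_fst).mul (by fun_prop)

lemma dominant_nonneg (hX : 0 < X) {p : ℝ × ℝ} (hp : p ∈ Ioi (0 : ℝ) ×ˢ Ioi (0 : ℝ)) :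
    0 ≤ dominant γ X p := by
  obtain ⟨h1, h2⟩ := hp
  rw [mem_Ioi] at h1 h2
  have : 0 ≤ min 1 (X / p.2) := le_min zero_le_one (by positivity)
  have : 0 ≤ (Iic X).indicator (1 : ℝ → ℝ) p.1 := indicator_nonneg (fun _ _ => zero_le_one) _
  unfold dominant
  positivity

lemma MassBound.ae_prod_pos (h : MassBound ρ μ) :
    ∀ᵐ p ∂μ.prod μ, p ∈ Ioi (0 : ℝ) ×ˢ Ioi (0 : ℝ) := by
  have := h.sigmaFinite
  have e : (μ.prod μ).restrict (Ioi (0 : ℝ) ×ˢ Ioi (0 : ℝ)) = μ.prod μ := by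
    rw [← Measure.prod_restrict, h.restrict_eq]
  rw [← e]
  exact ae_restrict_mem (measurableSet_Ioi.prod measurableSet_Ioi)

lemma MassBound.setLIntegral_dominant_le (h : MassBound ρ μ) {S T : Set ℝ} {c : ENNReal}
    (hc : ∀ y ∈ Ioc 0 X, ∫⁻ z in T, ENNReal.ofReal ((y ^ γ + z ^ γ) * min 1 (X / z)) ∂μ ≤ c) :
    ∫⁻ p in S ×ˢ T, ENNReal.ofReal (dominant γ X p) ∂μ.prod μ ≤ c * μ (Iic X ∩ S) := by
  have := h.sigmaFinite
  rw [← Measure.prod_restrict, lintegral_prod _ measurable_dominant.ennreal_ofReal.aemeasurable]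
  calc _ ≤ ∫⁻ y in S, (Iic X).indicator (fun _ => c) y ∂μ := by
        refine lintegral_mono_ae ((ae_restrict_of_ae h.ae_pos).mono fun y hy => ?_)
        by_cases hyX : y ≤ X
        · simpa [dominant, indicator, hyX] using hc y ⟨hy, hyX⟩
        · simp [dominant, indicator, hyX]
    _ = _ := by
        rw [lintegral_indicator measurableSet_Iic, setLIntegral_const,
          Measure.restrict_apply measurableSet_Iic]

lemma MassBound.lintegral_kernel_min_univ (h : MassBound ρ μ) (hγ : 0 ≤ γ) (hγρ : γ < ρ)
    (hρ : ρ < 1) {y : ℝ} (hy : y ∈ Ioc 0 X) :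
    ∫⁻ z in univ, ENNReal.ofReal ((y ^ γ + z ^ γ) * min 1 (X / z)) ∂μ ≤
      ENNReal.ofReal (momentConst γ ρ * X ^ (1 - ρ + γ)) := by
  have := h.lintegral_kernel_min hγ hγρ hρ hy.1 hy.2
  rwa [h.restrict_eq, ← Measure.restrict_univ (μ := μ)] at this

lemma MassBound.lintegral_dominant_lt_top (h : MassBound ρ μ) (hγ : 0 ≤ γ) (hγρ : γ < ρ)
    (hρ : ρ < 1) (hX : 0 < X) :
    ∫⁻ p, ENNReal.ofReal (dominant γ X p) ∂μ.prod μ < ⊤ := by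
  have h1 := h.setLIntegral_dominant_le (γ := γ) (X := X) (S := univ) (T := univ) fun y hy =>
    h.lintegral_kernel_min_univ hγ hγρ hρ hy
  rw [univ_prod_univ, Measure.restrict_univ] at h1
  refine h1.trans_lt (ENNReal.mul_lt_top ENNReal.ofReal_lt_top ?_)
  exact (h.measure_le hX inter_subset_left).trans_lt ENNReal.ofReal_lt_top

/-- Bound for the contribution of the complement of `[η, 1/η]²` to the double integrals. -/
def cutoffError (γ ρ X η : ℝ) : ℝ :=
  momentConst γ ρ * X ^ (1 - ρ + γ) * η ^ (1 - ρ) + 2 * X ^ γ * η ^ (1 - ρ) * X ^ (1 - ρ) +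
    2 * X * ((1 - γ) / (ρ - γ) * η ^ (ρ - γ)) * X ^ (1 - ρ)

lemma tendsto_cutoffError (hγρ : γ < ρ) (hρ : ρ < 1) :
    Tendsto (cutoffError γ ρ X) (𝓝[>] 0) (𝓝 0) := by
  have hc : Continuous (cutoffError γ ρ X) := by
    have h1 : Continuous fun η : ℝ => η ^ (1 - ρ) :=
      continuous_id.rpow_const fun _ => Or.inr (by linarith)
    have h2 : Continuous fun η : ℝ => η ^ (ρ - γ) :=
      continuous_id.rpow_const fun _ => Or.inr (by linarith)
    unfold cutoffError
    fun_prop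
  have h0 : cutoffError γ ρ X 0 = 0 := by
    simp [cutoffError, zero_rpow (sub_pos.2 hρ).ne', zero_rpow (sub_pos.2 hγρ).ne']
  have := hc.tendsto 0
  rw [h0] at this
  exact this.mono_left nhdsWithin_le_nhds

lemma MassBound.setLIntegral_dominant_compl_le (h : MassBound ρ μ) (hγ : 0 ≤ γ) (hγρ : γ < ρ)
    (hρ : ρ < 1) (hX : 1 ≤ X) {η : ℝ} (hη : 0 < η) (hηX : η ≤ 1 / X) :
    ∫⁻ p in Iio η ×ˢ univ ∪ (univ ×ˢ Iio η ∪ univ ×ˢ Ioi (1 / η)),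
      ENNReal.ofReal (dominant γ X p) ∂μ.prod μ ≤ ENNReal.ofReal (cutoffError γ ρ X η) := by
  have hX0 : 0 < X := by linarith
  have hA := one_le_momentConst hγ hγρ hρ
  have hq : 0 ≤ (1 - γ) / (ρ - γ) := div_nonneg (by linarith) (by linarith)
  have hXη : X ≤ 1 / η := by rwa [le_one_div hX0 hη]
  have hη1 : η ≤ X := hηX.trans (by rw [div_le_iff₀ hX0]; nlinarith)
  have h1 := h.setLIntegral_dominant_le (γ := γ) (X := X) (S := Iio η) (T := univ) fun y hy =>
    h.lintegral_kernel_min_univ hγ hγρ hρ hy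
  have h2 := h.setLIntegral_dominant_le (γ := γ) (X := X) (S := univ) (T := Iio η)
    (c := ENNReal.ofReal (2 * X ^ γ * η ^ (1 - ρ))) fun y hy => by
      have hsub : Iio η ∩ Ioi 0 ⊆ Ioc 0 η := fun z hz => ⟨hz.2, hz.1.le⟩
      rw [← h.restrict_eq, Measure.restrict_restrict measurableSet_Iio]
      refine (lintegral_mono_set hsub).trans (h.lintegral_Ioc_const hη (by positivity) ?_)
      intro z hz
      have hy1 := hy.1
      have hz1 := hz.1
      refine (mul_le_of_le_one_right (by positivity) (min_le_left _ _)).trans ?_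
      have := rpow_le_rpow hy1.le hy.2 hγ
      have := rpow_le_rpow hz1.le (hz.2.trans hη1) hγ
      linarith
  have h3 := h.setLIntegral_dominant_le (γ := γ) (X := X) (S := univ) (T := Ioi (1 / η))
    (c := ENNReal.ofReal (2 * X * ((1 - γ) / (ρ - γ) * η ^ (ρ - γ)))) fun y hy => by
      have hZ : 0 < 1 / η := by positivity
      have e : (1 / η) ^ (γ - ρ) = η ^ (ρ - γ) := by
        rw [one_div, inv_rpow hη.le, ← rpow_neg hη.le, neg_sub]
      rw [ENNReal.ofReal_mul (by positivity), ← e]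
      refine le_trans ?_ (mul_le_mul_right (h.lintegral_tail hγρ hρ hZ) _)
      rw [← lintegral_const_mul _ (by fun_prop)]
      refine (lintegral_mono_set Ioi_subset_Ici_self).trans
        (setLIntegral_mono (by fun_prop) fun z hz => ?_)
      have hz0 : 0 < z := hZ.trans_le hz
      rw [← ENNReal.ofReal_mul (by positivity)]
      refine ENNReal.ofReal_le_ofReal ?_
      have hyz : y ^ γ ≤ z ^ γ := rpow_le_rpow hy.1.le (hy.2.trans (hXη.trans hz)) hγ
      have hm : min 1 (X / z) ≤ X / z := min_le_right _ _
      calc (y ^ γ + z ^ γ) * min 1 (X / z) ≤ (z ^ γ + z ^ γ) * (X / z) := by gcongr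
        _ = 2 * X * z ^ (γ - 1) := by rw [rpow_sub_one hz0.ne']; ring
  have hm1 : μ (Iic X ∩ Iio η) ≤ ENNReal.ofReal (η ^ (1 - ρ)) :=
    h.measure_le hη fun z hz => (mem_Iio.1 hz.2).le
  have hm2 : μ (Iic X ∩ univ) ≤ ENNReal.ofReal (X ^ (1 - ρ)) := h.measure_le hX0 inter_subset_left
  refine (lintegral_union_le _ _ _).trans ?_
  refine (add_le_add (h1.trans (mul_le_mul_right hm1 _)) ((lintegral_union_le _ _ _).trans
    (add_le_add (h2.trans (mul_le_mul_right hm2 _)) (h3.trans (mul_le_mul_right hm2 _))))).trans_eq ?_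
  rw [← ENNReal.ofReal_mul (by positivity), ← ENNReal.ofReal_mul (by positivity),
    ← ENNReal.ofReal_mul (by positivity), ← ENNReal.ofReal_add (by positivity) (by positivity),
    ← ENNReal.ofReal_add (by positivity) (by positivity), cutoffError, add_assoc]

lemma MassBound.integrable_of_le_dominant (h : MassBound ρ μ) (hγ : 0 ≤ γ) (hγρ : γ < ρ)
    (hρ : ρ < 1) (hX : 0 < X) {G : ℝ × ℝ → ℝ} {B : ℝ}
    (hG : AEStronglyMeasurable G (μ.prod μ))
    (hGB : ∀ p ∈ Ioi (0 : ℝ) ×ˢ Ioi (0 : ℝ), |G p| ≤ B * dominant γ X p) :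
    Integrable G (μ.prod μ) := by
  refine Integrable.mono' (g := fun p => B * dominant γ X p) (Integrable.const_mul ?_ B) hG
    (h.ae_prod_pos.mono fun p hp => hGB p hp)
  refine ⟨measurable_dominant.aestronglyMeasurable, ?_⟩
  rw [hasFiniteIntegral_iff_ofReal (h.ae_prod_pos.mono fun p hp => dominant_nonneg hX hp)]
  exact h.lintegral_dominant_lt_top hγ hγρ hρ hX

lemma MassBound.aestronglyMeasurable_prod (h : MassBound ρ μ) {G : ℝ × ℝ → ℝ}
    (hG : ContinuousOn G (Ioi (0 : ℝ) ×ˢ Ioi (0 : ℝ))) : AEStronglyMeasurable G (μ.prod μ) := by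
  rw [← Measure.restrict_eq_self_of_ae_mem h.ae_prod_pos]
  exact hG.aestronglyMeasurable (measurableSet_Ioi.prod measurableSet_Ioi)

/-- A cutoff of a function on `(0, ∞)²` to a compact subset. -/
def cutoff (η : ℝ) (G : ℝ × ℝ → ℝ) (p : ℝ × ℝ) : ℝ :=
  plateau η (1 / η) (η / 2) p.1 * plateau η (1 / η) (η / 2) p.2 * G p

variable {G : ℝ × ℝ → ℝ} {η : ℝ}

lemma support_cutoff_subset (hη : 0 < η) : Function.support (cutoff η G) ⊆
    Icc (η - η / 2) (1 / η + η / 2) ×ˢ Icc (η - η / 2) (1 / η + η / 2) := by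
  intro p hp
  by_contra h
  refine hp ?_
  rw [mem_prod, not_and_or] at h
  rcases h with h | h
  · rw [cutoff, plateau_eq_zero (half_pos hη) h, zero_mul, zero_mul]
  · rw [cutoff, plateau_eq_zero (x := p.2) (half_pos hη) h, mul_zero, zero_mul]

lemma hasCompactSupport_cutoff (hη : 0 < η) : HasCompactSupport (cutoff η G) :=
  HasCompactSupport.of_support_subset_isCompact (isCompact_Icc.prod isCompact_Icc)
    (support_cutoff_subset hη)

lemma continuous_cutoff (hη : 0 < η) (hG : ContinuousOn G (Ioi (0 : ℝ) ×ˢ Ioi (0 : ℝ))) :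
    Continuous (cutoff η G) := by
  refine ContinuousOn.continuous_of_tsupport_subset (s := Ioi (0 : ℝ) ×ˢ Ioi (0 : ℝ)) ?_
    (isOpen_Ioi.prod isOpen_Ioi) ?_
  · unfold cutoff
    exact (((continuous_plateau.comp continuous_fst).mul
      (continuous_plateau.comp continuous_snd)).continuousOn).mul hG
  · refine (closure_minimal (support_cutoff_subset hη)
      (isClosed_Icc.prod isClosed_Icc)).trans (prod_mono ?_ ?_) <;>
    · intro x hx
      rw [mem_Ioi]
      linarith [hx.1]

lemma MassBound.abs_integral_sub_cutoff_le (h : MassBound ρ μ) (hγ : 0 ≤ γ) (hγρ : γ < ρ)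
    (hρ : ρ < 1) (hX : 1 ≤ X) {B : ℝ} (hB : 0 ≤ B)
    (hG : ContinuousOn G (Ioi (0 : ℝ) ×ˢ Ioi (0 : ℝ)))
    (hGB : ∀ p ∈ Ioi (0 : ℝ) ×ˢ Ioi (0 : ℝ), |G p| ≤ B * dominant γ X p)
    (hη : 0 < η) (hηX : η ≤ 1 / X) :
    |∫ p, G p ∂μ.prod μ - ∫ p, cutoff η G p ∂μ.prod μ| ≤ B * cutoffError γ ρ X η := by
  have := h.sigmaFinite
  have := h.isFiniteMeasureOnCompacts
  have hX0 : 0 < X := by linarith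
  have hXη : X ≤ 1 / η := by rwa [le_one_div hX0 hη]
  have hA := one_le_momentConst hγ hγρ hρ
  have hq : 0 ≤ (1 - γ) / (ρ - γ) := div_nonneg (by linarith) (by linarith)
  have hcle : ∀ p, |cutoff η G p| ≤ |G p| := fun p => by
    rw [cutoff, abs_mul, abs_of_nonneg (mul_nonneg plateau_nonneg plateau_nonneg)]
    exact mul_le_of_le_one_left (abs_nonneg _)
      (mul_le_one₀ plateau_le_one plateau_nonneg plateau_le_one)
  have hint := h.integrable_of_le_dominant hγ hγρ hρ hX0 (h.aestronglyMeasurable_prod hG) hGB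
  have hint' := h.integrable_of_le_dominant hγ hγρ hρ hX0
    (continuous_cutoff hη hG).aestronglyMeasurable fun p hp => (hcle p).trans (hGB p hp)
  rw [← integral_sub hint hint', ← norm_eq_abs]
  refine (norm_integral_le_lintegral_norm _).trans ?_
  refine ENNReal.toReal_le_of_le_ofReal (mul_nonneg hB (by unfold cutoffError; positivity)) ?_
  set S : Set (ℝ × ℝ) := Iio η ×ˢ univ ∪ (univ ×ˢ Iio η ∪ univ ×ˢ Ioi (1 / η)) with hS
  have hSm : MeasurableSet S := (measurableSet_Iio.prod .univ).union
    ((MeasurableSet.univ.prod measurableSet_Iio).union (MeasurableSet.univ.prod measurableSet_Ioi))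
  calc ∫⁻ p, ENNReal.ofReal ‖G p - cutoff η G p‖ ∂μ.prod μ
      ≤ ∫⁻ p, S.indicator (fun p => ENNReal.ofReal B * ENNReal.ofReal (dominant γ X p)) p
          ∂μ.prod μ := by
        refine lintegral_mono_ae (h.ae_prod_pos.mono fun p hp => ?_)
        have hGp := hGB p hp
        by_cases hpS : p ∈ S
        · rw [indicator_of_mem hpS, ← ENNReal.ofReal_mul hB]
          refine ENNReal.ofReal_le_ofReal (le_trans ?_ hGp)
          have e : G p - cutoff η G p = (1 - plateau η (1 / η) (η / 2) p.1 *
              plateau η (1 / η) (η / 2) p.2) * G p := by rw [cutoff]; ring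
          have h1 : plateau η (1 / η) (η / 2) p.1 * plateau η (1 / η) (η / 2) p.2 ≤ 1 :=
            mul_le_one₀ plateau_le_one plateau_nonneg plateau_le_one
          have h0 : 0 ≤ plateau η (1 / η) (η / 2) p.1 * plateau η (1 / η) (η / 2) p.2 :=
            mul_nonneg plateau_nonneg plateau_nonneg
          rw [e, norm_eq_abs, abs_mul, abs_of_nonneg (by linarith)]
          exact mul_le_of_le_one_left (abs_nonneg _) (by linarith)
        · rw [indicator_of_notMem hpS]
          simp only [hS, mem_union, mem_prod, mem_univ, mem_Iio, mem_Ioi, and_true, true_and,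
            not_or, not_lt] at hpS
          refine (ENNReal.ofReal_of_nonpos ?_).le
          rw [norm_le_zero_iff, sub_eq_zero]
          by_cases hpX : p.1 ≤ X
          · rw [cutoff, plateau_eq_one (half_pos hη) ⟨hpS.1, hpX.trans hXη⟩,
              plateau_eq_one (half_pos hη) hpS.2, one_mul, one_mul]
          · have : G p = 0 := by
              simpa [dominant, indicator, hpX] using hGp
            simp [cutoff, this]
    _ = ENNReal.ofReal B * ∫⁻ p in S, ENNReal.ofReal (dominant γ X p) ∂μ.prod μ := by
        rw [lintegral_indicator hSm, lintegral_const_mul _ measurable_dominant.ennreal_ofReal]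
    _ ≤ _ := by
        rw [ENNReal.ofReal_mul hB]
        gcongr
        exact h.setLIntegral_dominant_compl_le hγ hγρ hρ hX hη hηX

end Product

section DoubleLimit

variable {γ ρ : ℝ} {μ : Measure ℝ} {f : ℝ × ℝ → ℝ} {R : ℝ}

lemma integrable_section [IsFiniteMeasureOnCompacts μ] (hf : Continuous f)
    (hfR : ∀ p, p ∉ Icc (-R) R ×ˢ Icc (-R) R → f p = 0) (y : ℝ) :
    Integrable (fun z => f (y, z)) μ :=
  (hf.comp (Continuous.prodMk_right y)).integrable_of_hasCompactSupport
    (HasCompactSupport.intro (isCompact_Icc (a := -R) (b := R)) fun _ hz => hfR _ fun h => hz h.2)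

lemma MassBound.abs_integral_section_sub_le (h : MassBound ρ μ) (hR : 0 < R) (hf : Continuous f)
    (hfR : ∀ p, p ∉ Icc (-R) R ×ˢ Icc (-R) R → f p = 0) {y y' ε : ℝ}
    (hyy' : ∀ z, |f (y, z) - f (y', z)| ≤ ε) :
    |∫ z, f (y, z) ∂μ - ∫ z, f (y', z) ∂μ| ≤ ε * R ^ (1 - ρ) := by
  have := h.isFiniteMeasureOnCompacts
  rw [← integral_sub (integrable_section hf hfR y) (integrable_section hf hfR y')]
  refine h.norm_integral_le hR (fun z hz => ?_) hyy'
  rw [hfR _ fun h => not_le.2 hz h.2.2, hfR _ fun h => not_le.2 hz h.2.2, sub_zero]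

/-- Vague convergence of measures of the class `MassBound` passes to product measures. -/
lemma tendsto_integral_prod_of_vague {μ : ℕ → Measure ℝ} {ν : Measure ℝ}
    (hμ : ∀ N, MassBound ρ (μ N)) (hν : MassBound ρ ν) {𝓕 : Filter ℕ}
    (hlim : ∀ f : ℝ → ℝ, Continuous f → HasCompactSupport f →
      Tendsto (fun N => ∫ x, f x ∂μ N) 𝓕 (𝓝 (∫ x, f x ∂ν)))
    (hf : Continuous f) (hfc : HasCompactSupport f) :
    Tendsto (fun N => ∫ p, f p ∂(μ N).prod (μ N)) 𝓕 (𝓝 (∫ p, f p ∂ν.prod ν)) := by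
  have hμf : ∀ N, IsFiniteMeasureOnCompacts (μ N) := fun N => (hμ N).isFiniteMeasureOnCompacts
  have hνf := hν.isFiniteMeasureOnCompacts
  have hμσ : ∀ N, SigmaFinite (μ N) := fun N => (hμ N).sigmaFinite
  have hνσ := hν.sigmaFinite
  obtain ⟨R, hR, hfR⟩ : ∃ R > 0, ∀ p, p ∉ Icc (-R) R ×ˢ Icc (-R) R → f p = 0 := by
    obtain ⟨R, hR, hsub⟩ := hfc.isCompact.isBounded.subset_closedBall_lt 0 0
    refine ⟨R, hR, fun p hp => image_eq_zero_of_notMem_tsupport fun hpt => hp ?_⟩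
    have := hsub hpt
    rw [mem_closedBall_zero_iff, Prod.norm_def, max_le_iff, norm_eq_abs, norm_eq_abs, abs_le,
      abs_le] at this
    exact this
  set M := R ^ (1 - ρ) with hM
  have hM0 : 0 ≤ M := by positivity
  have huc := Metric.uniformContinuous_iff.1 (hfc.uniformContinuous_of_continuous hf)
  have hsec : ∀ ε > 0, ∃ d > 0, ∀ m, MassBound ρ m → ∀ y y', dist y y' < d →
      |∫ z, f (y, z) ∂m - ∫ z, f (y', z) ∂m| ≤ ε * M := by
    intro ε hε
    obtain ⟨d, hd, hfd⟩ := huc ε hε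
    refine ⟨d, hd, fun m hm y y' hy => hm.abs_integral_section_sub_le hR hf hfR fun z => ?_⟩
    refine (hfd (a := (y, z)) (b := (y', z)) ?_).le
    rw [Prod.dist_eq, dist_self]
    exact max_lt hy hd
  have hout : ∀ m : Measure ℝ, ∀ y, y ∉ Icc (-R) R → ∫ z, f (y, z) ∂m = 0 := fun m y hy => by
    rw [integral_congr_ae (Eventually.of_forall fun z => hfR (y, z) fun h => hy h.1)]
    simp
  have hcont : ∀ m, MassBound ρ m → Continuous fun y => ∫ z, f (y, z) ∂m := by
    intro m hm
    refine Metric.continuous_iff.2 fun y ε hε => ?_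
    obtain ⟨d, hd, hfd⟩ := hsec (ε / (M + 1)) (by positivity)
    refine ⟨d, hd, fun y' hy' => (hfd m hm y' y hy').trans_lt ?_⟩
    rw [div_mul_eq_mul_div, div_lt_iff₀ (by positivity)]
    nlinarith
  have hcs : ∀ m : Measure ℝ, HasCompactSupport fun y => ∫ z, f (y, z) ∂m := fun m =>
    HasCompactSupport.intro (isCompact_Icc (a := -R) (b := R)) fun y hy => hout m y hy
  have hsup : ∀ ε > 0, ∀ᶠ N in 𝓕, ∀ y,
      |∫ z, f (y, z) ∂μ N - ∫ z, f (y, z) ∂ν| ≤ (2 * M + 1) * ε := by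
    intro ε hε
    obtain ⟨d, hd, hfd⟩ := hsec ε hε
    obtain ⟨t, -, htf, ht⟩ := (isCompact_Icc (a := -R) (b := R)).finite_cover_balls hd
    have hpt : ∀ᶠ N in 𝓕, ∀ x ∈ t, |∫ z, f (x, z) ∂μ N - ∫ z, f (x, z) ∂ν| < ε := by
      refine (eventually_all_finite htf).2 fun x _ => ?_
      exact (Metric.tendsto_nhds.1 (hlim (fun z => f (x, z))
        (hf.comp (Continuous.prodMk_right x)) (HasCompactSupport.intro
          (isCompact_Icc (a := -R) (b := R)) fun z hz => hfR _ fun h => hz h.2))) ε hε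
    refine hpt.mono fun N hN y => ?_
    by_cases hy : y ∈ Icc (-R) R
    · obtain ⟨x, hx, hyx⟩ := mem_iUnion₂.1 (ht hy)
      have h1 := hfd (μ N) (hμ N) y x hyx
      have h2 := hfd ν hν y x hyx
      have h3 := hN x hx
      rw [abs_le] at h1 h2 ⊢
      rw [abs_lt] at h3
      constructor <;> linarith [h1.1, h1.2, h2.1, h2.2, h3.1, h3.2]
    · rw [hout _ y hy, hout _ y hy, sub_zero, abs_zero]
      positivity
  have hprod : ∀ m, MassBound ρ m → ∫ p, f p ∂m.prod m = ∫ y, ∫ z, f (y, z) ∂m ∂m := by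
    intro m hm
    have := hm.sigmaFinite
    have := hm.isFiniteMeasureOnCompacts
    exact integral_prod _ (hf.integrable_of_hasCompactSupport hfc)
  have hF := hlim _ (hcont ν hν) (hcs ν)
  rw [hprod ν hν]
  simp_rw [hprod _ (hμ _)]
  refine Metric.tendsto_nhds.2 fun ε hε => ?_
  filter_upwards [Metric.tendsto_nhds.1 hF (ε / 2) (by positivity),
    hsup (ε / (2 * ((2 * M + 1) * M + 1))) (by positivity)] with N h1 h2
  have h3 : |∫ y, ((∫ z, f (y, z) ∂μ N) - ∫ z, f (y, z) ∂ν) ∂μ N| ≤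
      (2 * M + 1) * (ε / (2 * ((2 * M + 1) * M + 1))) * M := by
    refine (hμ N).norm_integral_le hR (fun y hy => ?_) h2
    have hy' : y ∉ Icc (-R) R := fun h => not_le.2 hy h.2
    rw [hout _ y hy', hout _ y hy', sub_zero]
  rw [integral_sub ((hcont _ (hμ N)).integrable_of_hasCompactSupport (hcs _))
    ((hcont ν hν).integrable_of_hasCompactSupport (hcs _))] at h3
  have h4 : (2 * M + 1) * (ε / (2 * ((2 * M + 1) * M + 1))) * M < ε / 2 := by
    rw [mul_div_assoc', div_mul_eq_mul_div, div_lt_div_iff₀ (by positivity) (by positivity)]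
    nlinarith
  rw [dist_eq] at h1 ⊢
  rw [abs_lt] at h1 ⊢
  rw [abs_le] at h3
  constructor <;> linarith [h1.1, h1.2, h3.1, h3.2]

lemma tendsto_integral_prod_of_le_dominant {μ : ℕ → Measure ℝ} {ν : Measure ℝ}
    (hμ : ∀ N, MassBound ρ (μ N)) (hν : MassBound ρ ν) {𝓕 : Filter ℕ}
    (hlim : ∀ f : ℝ → ℝ, Continuous f → HasCompactSupport f →
      Tendsto (fun N => ∫ x, f x ∂μ N) 𝓕 (𝓝 (∫ x, f x ∂ν)))
    (hγ : 0 ≤ γ) (hγρ : γ < ρ) (hρ : ρ < 1) {X : ℝ} (hX : 1 ≤ X) {G : ℝ × ℝ → ℝ} {B : ℝ}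
    (hB : 0 ≤ B) (hG : ContinuousOn G (Ioi (0 : ℝ) ×ˢ Ioi (0 : ℝ)))
    (hGB : ∀ p ∈ Ioi (0 : ℝ) ×ˢ Ioi (0 : ℝ), |G p| ≤ B * dominant γ X p) :
    Tendsto (fun N => ∫ p, G p ∂(μ N).prod (μ N)) 𝓕 (𝓝 (∫ p, G p ∂ν.prod ν)) := by
  refine Metric.tendsto_nhds.2 fun ε hε => ?_
  have hsmall : ∀ᶠ η in 𝓝[>] 0, B * cutoffError γ ρ X η < ε / 3 := by
    have := (tendsto_cutoffError (X := X) hγρ hρ).const_mul B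
    rw [mul_zero] at this
    exact this.eventually_lt_const (by positivity)
  have hX0 : 0 < 1 / X := by positivity
  obtain ⟨η, hηs, hη⟩ := (hsmall.and (Ioo_mem_nhdsGT hX0)).exists
  filter_upwards [Metric.tendsto_nhds.1 (tendsto_integral_prod_of_vague hμ hν hlim
    (continuous_cutoff hη.1 hG) (hasCompactSupport_cutoff hη.1)) (ε / 3) (by positivity)] with N hN
  have h1 := (hμ N).abs_integral_sub_cutoff_le hγ hγρ hρ hX hB hG hGB hη.1 hη.2.le
  have h2 := hν.abs_integral_sub_cutoff_le hγ hγρ hρ hX hB hG hGB hη.1 hη.2.le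
  rw [dist_eq] at hN ⊢
  rw [abs_lt] at hN ⊢
  rw [abs_le] at h1 h2
  constructor <;> linarith [h1.1, h1.2, h2.1, h2.2, hN.1, hN.2]

end DoubleLimit

section Flux

variable {K : ℝ → ℝ → ℝ} {γ ρ C L X y z : ℝ} {ψ : ℝ → ℝ} {μ : Measure ℝ}

lemma setIntegral_abs_deriv_le (hψ : ContDiff ℝ 1 ψ)
    (hψX : ∀ x, X < x → deriv ψ x = 0) (hL : ∀ x, |deriv ψ x| ≤ L) (hy : 0 < y) (hz : 0 < z) :
    ∫ x in Icc y (y + z), |deriv ψ x| ≤ L * ((Iic X).indicator 1 y * min z X) := by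
  have hL0 : 0 ≤ L := (abs_nonneg _).trans (hL 0)
  have hle : ∫ x in Icc y (y + z), |deriv ψ x| ≤ ∫ x in Icc y (min (y + z) X), L := by
    have hint : IntegrableOn (fun x => |deriv ψ x|) (Icc y (y + z)) :=
      (hψ.continuous_deriv le_rfl).abs.integrableOn_Icc
    have hsub : Icc y (min (y + z) X) ⊆ Icc y (y + z) := Icc_subset_Icc_right (min_le_left _ _)
    rw [setIntegral_eq_of_subset_of_forall_sdiff_eq_zero measurableSet_Icc hsub]
    · exact setIntegral_mono (hint.mono_set hsub) (integrableOn_const (by simp)) hL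
    · intro x hx
      rw [hψX x, abs_zero]
      by_contra! h
      exact hx.2 ⟨hx.1.1, le_min hx.1.2 h⟩
  refine hle.trans ?_
  rw [setIntegral_const, smul_eq_mul, mul_comm, measureReal_def, Real.volume_Icc]
  refine mul_le_mul_of_nonneg_left ?_ hL0
  by_cases hyX : y ≤ X
  · rw [indicator_of_mem (mem_Iic.2 hyX), Pi.one_apply, one_mul, ENNReal.toReal_ofReal
      (sub_nonneg.2 (le_min (by linarith) hyX))]
    exact le_min (by linarith [min_le_left (y + z) X]) (by linarith [min_le_right (y + z) X])
  · rw [indicator_of_notMem (by simpa using hyX), zero_mul, ENNReal.ofReal_of_nonpos]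
    · simp
    · linarith [min_le_right (y + z) X]

lemma setIntegral_deriv_eq_sub (hψ : ContDiff ℝ 1 ψ) (hz : 0 < z) :
    ∫ x in Icc y (y + z), deriv ψ x = ψ (y + z) - ψ y := by
  rw [integral_Icc_eq_integral_Ioc, ← intervalIntegral.integral_of_le (by linarith)]
  exact intervalIntegral.integral_deriv_eq_sub
    (fun x _ => (hψ.differentiable one_ne_zero).differentiableAt)
    ((hψ.continuous_deriv le_rfl).intervalIntegrable _ _)

lemma KernelHyp.div_mul_setIntegral_le (hK : KernelHyp K γ C) (hψ : ContDiff ℝ 1 ψ)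
    (hX : 0 < X) (hψX : ∀ x, X < x → deriv ψ x = 0) (hL : ∀ x, |deriv ψ x| ≤ L)
    {p : ℝ × ℝ} (hp : p ∈ Ioi (0 : ℝ) ×ˢ Ioi (0 : ℝ)) :
    K p.1 p.2 / p.2 * ∫ x in Icc p.1 (p.1 + p.2), |deriv ψ x| ≤ C * L * dominant γ X p := by
  obtain ⟨hy, hz⟩ := hp
  rw [mem_Ioi] at hy hz
  have hL0 : 0 ≤ L := (abs_nonneg _).trans (hL 0)
  have hK0 := hK.nonneg _ _ hy hz
  have hi : 0 ≤ (Iic X).indicator (1 : ℝ → ℝ) p.1 := indicator_nonneg (fun _ _ => zero_le_one) _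
  have hm : min p.2 X = p.2 * min 1 (X / p.2) := by
    rw [mul_min_of_nonneg _ _ hz.le, mul_one, mul_div_cancel₀ _ hz.ne']
  have hm0 : 0 ≤ min 1 (X / p.2) := le_min zero_le_one (by positivity)
  calc K p.1 p.2 / p.2 * ∫ x in Icc p.1 (p.1 + p.2), |deriv ψ x|
      ≤ K p.1 p.2 / p.2 * (L * ((Iic X).indicator 1 p.1 * min p.2 X)) := by
        gcongr
        exact setIntegral_abs_deriv_le hψ hψX hL hy hz
    _ = L * (Iic X).indicator 1 p.1 * min 1 (X / p.2) * K p.1 p.2 := by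
        rw [hm]; field_simp
    _ ≤ L * (Iic X).indicator 1 p.1 * min 1 (X / p.2) * (C * (p.1 ^ γ + p.2 ^ γ)) := by
        gcongr
        exact hK.growth _ _ hy hz
    _ = _ := by unfold dominant; ring

lemma KernelHyp.abs_weak_integrand_le (hK : KernelHyp K γ C) (hψ : ContDiff ℝ 1 ψ)
    (hX : 0 < X) (hψX : ∀ x, X < x → deriv ψ x = 0) (hL : ∀ x, |deriv ψ x| ≤ L)
    {p : ℝ × ℝ} (hp : p ∈ Ioi (0 : ℝ) ×ˢ Ioi (0 : ℝ)) :
    |K p.1 p.2 / p.2 * (ψ (p.1 + p.2) - ψ p.1)| ≤ C * L * dominant γ X p := by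
  refine le_trans ?_ (hK.div_mul_setIntegral_le hψ hX hψX hL hp)
  have h0 := div_nonneg (hK.nonneg _ _ hp.1 hp.2) (mem_Ioi.1 hp.2).le
  rw [abs_mul, abs_of_nonneg h0, ← setIntegral_deriv_eq_sub hψ hp.2]
  exact mul_le_mul_of_nonneg_left abs_integral_le_integral_abs h0

lemma KernelHyp.continuousOn_div (hK : KernelHyp K γ C) :
    ContinuousOn (fun p : ℝ × ℝ => K p.1 p.2 / p.2) (Ioi (0 : ℝ) ×ˢ Ioi (0 : ℝ)) :=
  hK.cont.div continuousOn_snd fun _ hp => (mem_Ioi.1 hp.2).ne'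

/-- The integrand of the flux tested against `deriv ψ`, as a function on `ℝ × (ℝ × ℝ)`. -/
def fluxIntegrand (K : ℝ → ℝ → ℝ) (ψ : ℝ → ℝ) (q : ℝ × ℝ × ℝ) : ℝ :=
  {q : ℝ × ℝ × ℝ | q.1 ∈ Icc q.2.1 (q.2.1 + q.2.2)}.indicator
    (fun q => deriv ψ q.1 * (K q.2.1 q.2.2 / q.2.2)) q

lemma fluxIntegrand_eq (x : ℝ) (p : ℝ × ℝ) : fluxIntegrand K ψ (x, p) =
    K p.1 p.2 / p.2 * (Icc p.1 (p.1 + p.2)).indicator (deriv ψ) x := by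
  by_cases h : x ∈ Icc p.1 (p.1 + p.2)
  · rw [fluxIntegrand, indicator_of_mem (by exact h), indicator_of_mem h, mul_comm]
  · rw [fluxIntegrand, indicator_of_notMem (by exact h), indicator_of_notMem h, mul_zero]

lemma integral_fluxIntegrand (hψ : ContDiff ℝ 1 ψ) {p : ℝ × ℝ}
    (hp : p ∈ Ioi (0 : ℝ) ×ˢ Ioi (0 : ℝ)) :
    ∫ x in Ioi (0 : ℝ), fluxIntegrand K ψ (x, p) = K p.1 p.2 / p.2 * (ψ (p.1 + p.2) - ψ p.1) := by
  have hsub : Icc p.1 (p.1 + p.2) ⊆ Ioi 0 := fun x hx => (mem_Ioi.1 hp.1).trans_le hx.1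
  simp_rw [fluxIntegrand_eq]
  rw [integral_const_mul, setIntegral_indicator measurableSet_Icc, inter_eq_right.2 hsub,
    setIntegral_deriv_eq_sub hψ hp.2]

lemma integral_norm_fluxIntegrand (hK : KernelHyp K γ C) {p : ℝ × ℝ}
    (hp : p ∈ Ioi (0 : ℝ) ×ˢ Ioi (0 : ℝ)) :
    ∫ x in Ioi (0 : ℝ), ‖fluxIntegrand K ψ (x, p)‖ =
      K p.1 p.2 / p.2 * ∫ x in Icc p.1 (p.1 + p.2), |deriv ψ x| := by
  have hsub : Icc p.1 (p.1 + p.2) ⊆ Ioi 0 := fun x hx => (mem_Ioi.1 hp.1).trans_le hx.1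
  have h0 := div_nonneg (hK.nonneg _ _ hp.1 hp.2) (mem_Ioi.1 hp.2).le
  simp_rw [fluxIntegrand_eq, norm_mul, norm_of_nonneg h0, norm_indicator_eq_indicator_norm]
  rw [integral_const_mul, setIntegral_indicator measurableSet_Icc, inter_eq_right.2 hsub]
  rfl

lemma MassBound.aestronglyMeasurable_fluxIntegrand (h : MassBound ρ μ) (hK : KernelHyp K γ C)
    (hψ : ContDiff ℝ 1 ψ) : AEStronglyMeasurable (fluxIntegrand K ψ)
      ((volume.restrict (Ioi 0)).prod (μ.prod μ)) := by
  have := h.sigmaFinite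
  have hS : MeasurableSet {q : ℝ × ℝ × ℝ | q.1 ∈ Icc q.2.1 (q.2.1 + q.2.2)} := by
    simp only [mem_Icc]
    measurability
  refine AEStronglyMeasurable.indicator (AEStronglyMeasurable.mul ?_ ?_) hS
  · exact ((hψ.continuous_deriv le_rfl).comp continuous_fst).aestronglyMeasurable
  · exact (h.aestronglyMeasurable_prod hK.continuousOn_div).comp_snd

lemma MassBound.integrable_fluxIntegrand (h : MassBound ρ μ) (hγ : 0 ≤ γ) (hγρ : γ < ρ)
    (hρ : ρ < 1) (hK : KernelHyp K γ C) (hψ : ContDiff ℝ 1 ψ)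
    (hX : 0 < X) (hψX : ∀ x, X < x → deriv ψ x = 0) (hL : ∀ x, |deriv ψ x| ≤ L) :
    Integrable (fluxIntegrand K ψ) ((volume.restrict (Ioi 0)).prod (μ.prod μ)) := by
  have := h.sigmaFinite
  have hm := h.aestronglyMeasurable_fluxIntegrand hK hψ
  refine (integrable_prod_iff' hm).2 ⟨Eventually.of_forall fun p => ?_, ?_⟩
  · simp_rw [fluxIntegrand_eq]
    refine Integrable.const_mul ?_ _
    exact ((hψ.continuous_deriv le_rfl).integrableOn_Icc.integrable_indicator
      measurableSet_Icc).restrict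
  · refine h.integrable_of_le_dominant (B := C * L) hγ hγρ hρ hX hm.norm.prod_swap.integral_prod_right'
      fun p hp => ?_
    rw [abs_of_nonneg (integral_nonneg fun x => norm_nonneg _), integral_norm_fluxIntegrand hK hp]
    exact hK.div_mul_setIntegral_le hψ hX hψX hL hp

/-- Integrating the flux against `deriv ψ` gives the double integral of the weak formulation. -/
lemma MassBound.integral_deriv_mul_Imeas (h : MassBound ρ μ) (hγ : 0 ≤ γ) (hγρ : γ < ρ)
    (hρ : ρ < 1) (hK : KernelHyp K γ C) (hψ : ContDiff ℝ 1 ψ)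
    (hX : 0 < X) (hψX : ∀ x, X < x → deriv ψ x = 0) (hL : ∀ x, |deriv ψ x| ≤ L) :
    ∫ x in Ioi (0 : ℝ), deriv ψ x * Imeas K μ x =
      ∫ p, K p.1 p.2 / p.2 * (ψ (p.1 + p.2) - ψ p.1) ∂μ.prod μ := by
  have := h.sigmaFinite
  have hint := h.integrable_fluxIntegrand hγ hγρ hρ hK hψ hX hψX hL
  calc ∫ x in Ioi (0 : ℝ), deriv ψ x * Imeas K μ x
      = ∫ x in Ioi (0 : ℝ), ∫ p, fluxIntegrand K ψ (x, p) ∂μ.prod μ := by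
        refine integral_congr_ae (hint.prod_right_ae.mono fun x hx => ?_)
        dsimp only
        rw [integral_prod _ hx, Imeas, ← integral_const_mul, ← integral_indicator measurableSet_Ioc]
        refine integral_congr_ae (h.ae_pos.mono fun y hy => ?_)
        dsimp only
        by_cases hyx : y ≤ x
        · rw [indicator_of_mem (by exact ⟨hy, hyx⟩), ← integral_const_mul,
            ← integral_indicator measurableSet_Ici]
          refine integral_congr_ae (Eventually.of_forall fun z => ?_)
          have e : z ∈ Ici (x - y) ↔ x ∈ Icc y (y + z) := by
            rw [mem_Ici, mem_Icc, sub_le_iff_le_add']; tauto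
          by_cases hz : z ∈ Ici (x - y)
          · simp only [fluxIntegrand_eq]
            rw [indicator_of_mem hz, indicator_of_mem (e.1 hz), mul_comm]
          · simp only [fluxIntegrand_eq]
            rw [indicator_of_notMem hz, indicator_of_notMem (fun h => hz (e.2 h)), mul_zero]
        · rw [indicator_of_notMem fun h => hyx h.2]
          simp [fluxIntegrand_eq, indicator, hyx]
    _ = ∫ p, (∫ x in Ioi (0 : ℝ), fluxIntegrand K ψ (x, p)) ∂μ.prod μ :=
        integral_integral_swap (f := fun x p => fluxIntegrand K ψ (x, p)) hint
    _ = _ := integral_congr_ae (h.ae_prod_pos.mono fun p hp => integral_fluxIntegrand hψ hp)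

end Flux

lemma MassBound.weak_equation_of_vague_limit {K : ℝ → ℝ → ℝ} {γ ρ C : ℝ} {μ : ℕ → Measure ℝ}
    {ν : Measure ℝ} (hγ : 0 ≤ γ) (hγρ : γ < ρ) (hρ : ρ < 1) (hC : 0 < C) (hK : KernelHyp K γ C)
    (hμ : ∀ N, MassBound ρ (μ N)) (hν : MassBound ρ ν) {𝓕 : Filter ℕ} [𝓕.NeBot]
    (hlim : ∀ f : ℝ → ℝ, Continuous f → HasCompactSupport f →
      Tendsto (fun N => ∫ x, f x ∂μ N) 𝓕 (𝓝 (∫ x, f x ∂ν)))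
    {ψ : ℝ → ℝ} (hψ : ContDiff ℝ 1 ψ) (hψc : HasCompactSupport ψ)
    (herr : Tendsto (fun N => ∫ x, x * deriv ψ x + (1 - ρ) * ψ x ∂μ N -
      (ρ - γ) * ∫ y, ∫ z, K y z / z * (ψ (y + z) - ψ y) ∂μ N ∂μ N) 𝓕 (𝓝 0)) :
    (ρ - γ) * ∫ x in Ioi (0 : ℝ), deriv ψ x * Imeas K ν x =
      ∫ x, x * deriv ψ x + (1 - ρ) * ψ x ∂ν := by
  have hd := hψ.continuous_deriv le_rfl
  obtain ⟨L, hL⟩ := hd.bounded_above_of_compact_support hψc.deriv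
  have hL0 : 0 ≤ L := (norm_nonneg _).trans (hL 0)
  obtain ⟨X, hX1, hXd⟩ : ∃ X, 1 ≤ X ∧ ∀ x, X < x → deriv ψ x = 0 := by
    obtain ⟨X, hX⟩ := hψc.deriv.isCompact.bddAbove
    refine ⟨max 1 X, le_max_left _ _, fun x hx => image_eq_zero_of_notMem_tsupport fun h => ?_⟩
    exact absurd (hX h) (not_le.2 ((le_max_right _ _).trans_lt hx))
  have hX0 : 0 < X := by linarith
  have hGB := fun (p : ℝ × ℝ) hp =>
    hK.abs_weak_integrand_le (γ := γ) (p := p) hψ hX0 hXd hL hp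
  have hG : ContinuousOn (fun p : ℝ × ℝ => K p.1 p.2 / p.2 * (ψ (p.1 + p.2) - ψ p.1))
      (Ioi (0 : ℝ) ×ˢ Ioi (0 : ℝ)) := by
    have := hψ.continuous
    exact hK.continuousOn_div.mul (by fun_prop)
  have hiter : ∀ m, MassBound ρ m → ∫ y, ∫ z, K y z / z * (ψ (y + z) - ψ y) ∂m ∂m =
      ∫ p, K p.1 p.2 / p.2 * (ψ (p.1 + p.2) - ψ p.1) ∂m.prod m := fun m hm => by
    have := hm.sigmaFinite
    rw [integral_prod _ (hm.integrable_of_le_dominant hγ hγρ hρ hX0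
      (hm.aestronglyMeasurable_prod hG) hGB)]
  simp_rw [fun N => hiter _ (hμ N)] at herr
  have h1 := hlim (fun x => x * deriv ψ x + (1 - ρ) * ψ x)
    ((continuous_id.mul hd).add (hψ.continuous.const_mul _))
    (hψc.deriv.mul_left.add hψc.mul_left)
  have h2 := tendsto_integral_prod_of_le_dominant hμ hν hlim hγ hγρ hρ hX1 (by positivity) hG hGB
  have h3 := tendsto_nhds_unique herr (h1.sub (h2.const_mul (ρ - γ)))
  rw [hν.integral_deriv_mul_Imeas hγ hγρ hρ hK hψ hX0 hXd hL]
  linarith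

lemma mul_max_one_sub_div_rpow_le {γ ρ δ B R R₀ : ℝ} (hγρ : γ < ρ) (hδ : δ ∈ Ioo 0 (ρ - γ))
    (hB : 0 < B) (hR : 0 < R) (hR₀ : B ^ (1 / (ρ - γ)) ≤ R₀) :
    ENNReal.ofReal (R ^ (1 - ρ) * max (1 - (R₀ / R) ^ δ) 0) ≤
      ENNReal.ofReal (R ^ (1 - ρ) * (1 - B * R ^ (γ - ρ))) := by
  have hs : 0 < ρ - γ := sub_pos.2 hγρ
  have hR₀0 : 0 < R₀ := (rpow_pos_of_pos hB _).trans_le hR₀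
  rcases le_total R R₀ with h | h
  · have : 1 ≤ (R₀ / R) ^ δ := one_le_rpow ((one_le_div hR).2 h) hδ.1.le
    rw [max_eq_right (by linarith), mul_zero, ENNReal.ofReal_zero]
    exact zero_le
  · have hq1 : R₀ / R ≤ 1 := (div_le_one hR).2 h
    have hBR : B ≤ R₀ ^ (ρ - γ) := by
      have := rpow_le_rpow (by positivity) hR₀ hs.le
      rwa [← rpow_mul hB.le, one_div_mul_cancel hs.ne', rpow_one] at this
    have e : B * R ^ (γ - ρ) ≤ (R₀ / R) ^ δ := calc
      B * R ^ (γ - ρ) ≤ R₀ ^ (ρ - γ) * R ^ (γ - ρ) := by gcongr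
      _ = (R₀ / R) ^ (ρ - γ) := by
        rw [div_rpow hR₀0.le hR.le, ← neg_sub ρ γ, rpow_neg hR.le, div_eq_mul_inv]
      _ ≤ (R₀ / R) ^ δ := rpow_le_rpow_of_exponent_ge (by positivity) hq1 hδ.2.le
    have : (R₀ / R) ^ δ ≤ 1 := rpow_le_one (by positivity) hq1 hδ.1.le
    rw [max_eq_left (by linarith)]
    gcongr

/-- Existence of a weak stationary solution in the invariant set `𝒴`: a nonnegative Radon
measure `h` on `[0,∞)` with `R^{ρ-1}∫_{[0,R]}dh ≤ 1` and
`R^{ρ-1}∫_{[0,R]}dh ≥ (1-(R₀/R)^δ)₊` satisfying the weak stationary equation. -/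
theorem existence_of_selfsimilar_measure_in_Y
    (γ C ρ β δ : ℝ) (K : ℝ → ℝ → ℝ)
    (hγ : γ ∈ Ico (0:ℝ) 1) (hC : 0 < C) (hK : KernelHyp K γ C)
    (hρ : ρ ∈ Ioo γ 1) (hβ : β = 1 / (ρ - γ)) (hδ : δ ∈ Ioo 0 (ρ - γ)) :
    ∃ Rstar : ℝ, 0 < Rstar ∧ ∀ R₀ ≥ Rstar,
      ∃ μ : Measure ℝ,
        μ (Iio 0) = 0 ∧
        (∀ R > (0:ℝ), μ (Icc 0 R) ≤ ENNReal.ofReal (R ^ (1 - ρ))) ∧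
        (∀ R > (0:ℝ),
          ENNReal.ofReal (R ^ (1 - ρ) * max (1 - (R₀ / R) ^ δ) 0) ≤ μ (Icc 0 R)) ∧
        (∀ ψ : ℝ → ℝ, ContDiff ℝ 1 ψ → HasCompactSupport ψ →
          (∫ x in Ioi (0:ℝ), deriv ψ x * Imeas K μ x)
            - β * (∫ x, deriv (fun w => w * ψ w) x ∂μ)
            + β * ρ * (∫ x, ψ x ∂μ) = 0) := by
  obtain ⟨hγρ, hρ1⟩ := hρ
  obtain ⟨B, hB, μ, hμ, hlow, herr⟩ := exists_approximating_sequence hγ.1 hγρ hρ1 hC hK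
  obtain ⟨ν, hν, hlim⟩ := exists_vague_limit hρ1 μ hμ (hyperfilter ℕ)
  refine ⟨B ^ (1 / (ρ - γ)), by positivity, fun R₀ hR₀ => ⟨ν, ?_, hν.le, fun R hR => ?_,
    fun ψ hψ hψc => ?_⟩⟩
  · exact measure_mono_null Iio_subset_Iic_self hν.null
  · refine (mul_max_one_sub_div_rpow_le hγρ hδ hB hR hR₀).trans
      (hν.le_of_vague_limit hμ (ℓ := fun R => R ^ (1 - ρ) * (1 - B * R ^ (γ - ρ))) hlim ?_
        (fun R R' h h' => (hlow R R' h h').filter_mono Nat.hyperfilter_le_atTop) hR)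
    have hc : ∀ s : ℝ, ContinuousOn (fun R : ℝ => R ^ s) (Ioi 0) := fun s =>
      continuousOn_id.rpow_const fun x hx => Or.inl (mem_Ioi.1 hx).ne'
    exact (hc _).mul (continuousOn_const.sub (continuousOn_const.mul (hc _)))
  · have hs : ρ - γ ≠ 0 := (sub_pos.2 hγρ).ne'
    have hfin := hν.isFiniteMeasureOnCompacts
    have hw := MassBound.weak_equation_of_vague_limit hγ.1 hγρ hρ1 hC hK hμ hν hlim hψ hψc
      ((herr ψ hψ hψc).mono_left Nat.hyperfilter_le_atTop)
    have hderiv : ∀ x, deriv (fun w => w * ψ w) x = ψ x + x * deriv ψ x := fun x => by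
      rw [deriv_fun_mul differentiableAt_fun_id (hψ.differentiable one_ne_zero).differentiableAt,
        deriv_id'', one_mul]
    have hi1 : Integrable ψ ν := hψ.continuous.integrable_of_hasCompactSupport hψc
    have hi2 : Integrable (fun x => x * deriv ψ x) ν :=
      (continuous_id.mul (hψ.continuous_deriv le_rfl)).integrable_of_hasCompactSupport
        hψc.deriv.mul_left
    rw [integral_add hi2 (hi1.const_mul _), integral_const_mul] at hw
    simp_rw [hderiv]
    rw [integral_add hi1 hi2, hβ]
    field_simp
    linarith

end Smol
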